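/- Let α be an action of a countable group Γ by homeomorphisms on a compact metrizable 0-dimensional space X. Then the topological full group ⟦α⟧ admits a dense locally finite subgroup if and only if T(α) is unperforated and cancellative. -/

import Mathlib

open MeasureTheory Set
open scoped ENNReal

/-! Preliminary definitions: the clopen type semigroup of an action of a group `Γ`
by homeomorphisms on a topological space `X`, invariant measures, dynamical comparison,
topological full groups, and the topology on spaces of actions. -/

/-- The group of self-homeomorphisms of `X`, with `(g * h) x = g (h x)`. -/
instance homeoGroup (X : Type*) [TopologicalSpace X] : Group (X ≃ₜ X) where
  mul g h := h.trans g
  one := Homeomorph.refl X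
  inv := Homeomorph.symm
  mul_assoc a b c := Homeomorph.ext fun _ => rfl
  one_mul a := Homeomorph.ext fun _ => rfl
  mul_one a := Homeomorph.ext fun _ => rfl
  inv_mul_cancel a := Homeomorph.ext fun x => a.symm_apply_apply x

/-- The Cantor space `{0,1}^ℕ`. -/
abbrev Cantor : Type := ℕ → Bool

section Defs

variable {Γ : Type*} [Group Γ] {X : Type*} [TopologicalSpace X]

/-- A left-invariant finitely additive probability measure on (the power set of) `Γ`,
with values in `[0,1]`. `Γ` is amenable iff such a measure exists. -/
def IsInvFapm {Γ : Type*} [Group Γ] (m : Set Γ → ℝ) : Prop :=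
  (∀ E : Set Γ, 0 ≤ m E) ∧ (∀ E : Set Γ, m E ≤ 1) ∧ m Set.univ = 1 ∧
  (∀ E F : Set Γ, Disjoint E F → m (E ∪ F) = m E + m F) ∧
  (∀ (γ : Γ) (E : Set Γ), m ((γ * ·) '' E) = m E)

/-- The action of `γ ∈ Γ` on continuous `ℕ`-valued functions: `(γ · f)(x) = f(γ⁻¹ · x)`. -/
def actC (α : Γ →* X ≃ₜ X) (γ : Γ) (f : C(X, ℕ)) : C(X, ℕ) :=
  f.comp (α γ⁻¹)

/-- The equidecomposability relation `∼` on `C(X, ℕ)`: `f ∼ g` iff `f = h₁ + ⋯ + hₙ`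
and `g = γ₁·h₁ + ⋯ + γₙ·hₙ` for some `hᵢ ∈ C(X,ℕ)`, `γᵢ ∈ Γ`. -/
def TypeRel (α : Γ →* X ≃ₜ X) (f g : C(X, ℕ)) : Prop :=
  ∃ (n : ℕ) (h : Fin n → C(X, ℕ)) (γ : Fin n → Γ),
    f = ∑ i, h i ∧ g = ∑ i, actC α (γ i) (h i)

/-- The additive congruence on `C(X, ℕ)` generated by `∼` (since `∼` is itself an
additive congruence, this is just `∼`). -/
def typeCon (α : Γ →* X ≃ₜ X) : AddCon C(X, ℕ) := addConGen (TypeRel α)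

/-- The clopen type semigroup `T(α) = C(X,ℕ)/∼`. -/
abbrev TypeSemigroup (α : Γ →* X ≃ₜ X) := (typeCon α).Quotient

/-- The class `[f] ∈ T(α)` of `f ∈ C(X, ℕ)`. -/
def cls (α : Γ →* X ≃ₜ X) (f : C(X, ℕ)) : TypeSemigroup α := (typeCon α).toQuotient f

/-- The algebraic preorder on `T(α)`: `a ≤ b` iff `a + c = b` for some `c`. -/
def tle (α : Γ →* X ≃ₜ X) (a b : TypeSemigroup α) : Prop := ∃ c, a + c = b

/-- `T(α)` is unperforated: `n • a ≤ n • b` implies `a ≤ b` for all `n ≥ 1`. -/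
def IsUnperforated (α : Γ →* X ≃ₜ X) : Prop :=
  ∀ (a b : TypeSemigroup α) (n : ℕ), 1 ≤ n → tle α (n • a) (n • b) → tle α a b

/-- `T(α)` is almost unperforated: `(n+1) • a ≤ n • b` implies `a ≤ b`. -/
def IsAlmostUnperforated (α : Γ →* X ≃ₜ X) : Prop :=
  ∀ (a b : TypeSemigroup α) (n : ℕ), tle α ((n + 1) • a) (n • b) → tle α a b

/-- `T(α)` is cancellative: `a + b = a + c` implies `b = c`. -/
def IsCancellative (α : Γ →* X ≃ₜ X) : Prop :=
  ∀ a b c : TypeSemigroup α, a + b = a + c → b = c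

/-- The algebraic preorder on `T(α)` is a partial order, i.e. it is antisymmetric. -/
def TleAntisymm (α : Γ →* X ≃ₜ X) : Prop :=
  ∀ a b : TypeSemigroup α, tle α a b → tle α b a → a = b

/-- `b` is an order unit of `T(α)`: every `a` satisfies `a ≤ k • b` for some `k ∈ ℕ`. -/
def IsOrderUnit (α : Γ →* X ≃ₜ X) (b : TypeSemigroup α) : Prop :=
  ∀ a : TypeSemigroup α, ∃ k : ℕ, tle α a (k • b)

/-- A state on `T(α)`: an additive map to `[0,∞]` sending `0` to `0`. -/
def IsState (α : Γ →* X ≃ₜ X) (ν : TypeSemigroup α → ℝ≥0∞) : Prop :=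
  ν 0 = 0 ∧ ∀ a b : TypeSemigroup α, ν (a + b) = ν a + ν b

/-- `M(α)`: the set of `Γ`-invariant Radon (regular Borel) probability measures on `X`. -/
def invRadon (α : Γ →* X ≃ₜ X) : Set (@Measure X (borel X)) :=
  letI : MeasurableSpace X := borel X
  {μ : Measure X | IsProbabilityMeasure μ ∧ μ.Regular ∧ ∀ γ : Γ, Measure.map ⇑(α γ) μ = μ}

/-- The set of `Γ`-invariant Borel probability measures on `X`. -/
def invBorel (α : Γ →* X ≃ₜ X) : Set (@Measure X (borel X)) :=
  letI : MeasurableSpace X := borel X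
  {μ : Measure X | IsProbabilityMeasure μ ∧ ∀ γ : Γ, Measure.map ⇑(α γ) μ = μ}

/-- `μ([f]) = ∫ f dμ`, the value of (the state associated with) a measure on the class of
`f ∈ C(X, ℕ)`. -/
noncomputable def intOf {X : Type*} [TopologicalSpace X] (μ : @Measure X (borel X))
    (f : C(X, ℕ)) : ℝ :=
  letI : MeasurableSpace X := borel X
  ∫ x, (f x : ℝ) ∂μ

/-- `A` is subequidecomposable to `B`: there are a partition `A = A₁ ⊔ ⋯ ⊔ Aₙ` into clopen
sets and `γ₁, …, γₙ ∈ Γ` with `γ₁A₁, …, γₙAₙ` pairwise disjoint and contained in `B`. -/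
def Subequidecomposable (α : Γ →* X ≃ₜ X) (A B : Set X) : Prop :=
  ∃ (n : ℕ) (P : Fin n → Set X) (γ : Fin n → Γ),
    (∀ i, IsClopen (P i)) ∧ (Pairwise fun i j => Disjoint (P i) (P j)) ∧
    (⋃ i, P i) = A ∧
    (Pairwise fun i j => Disjoint (⇑(α (γ i)) '' P i) (⇑(α (γ j)) '' P j)) ∧
    ∀ i, ⇑(α (γ i)) '' P i ⊆ B

/-- Dynamical comparison (with respect to invariant Radon probability measures): for all
clopen `A`, `B` with `B` nonempty and `μ(A) < μ(B)` for every `μ ∈ M(α)`, `A` is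
subequidecomposable to `B`. -/
def DynComparison (α : Γ →* X ≃ₜ X) : Prop :=
  ∀ A B : Set X, IsClopen A → IsClopen B → B.Nonempty →
    (∀ μ ∈ invRadon α, μ A < μ B) → Subequidecomposable α A B

/-- Dynamical comparison (with respect to invariant Borel probability measures). -/
def DynComparisonBorel (α : Γ →* X ≃ₜ X) : Prop :=
  ∀ A B : Set X, IsClopen A → IsClopen B → B.Nonempty →
    (∀ μ ∈ invBorel α, μ A < μ B) → Subequidecomposable α A B

/-- The action `α` is minimal: the only closed invariant subsets are `∅` and `X`. -/
def IsMinimalAction (α : Γ →* X ≃ₜ X) : Prop :=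
  ∀ F : Set X, IsClosed F → (∀ γ : Γ, ⇑(α γ) '' F ⊆ F) → F = ∅ ∨ F = Set.univ

/-- Membership in the topological full group `⟦α⟧`: `g` coincides with elements of the
action on the pieces of a finite clopen partition of `X`. -/
def InTopFullGroup (α : Γ →* X ≃ₜ X) (g : X ≃ₜ X) : Prop :=
  ∃ (n : ℕ) (P : Fin n → Set X) (γ : Fin n → Γ),
    (∀ i, IsClopen (P i)) ∧ (Pairwise fun i j => Disjoint (P i) (P j)) ∧
    (⋃ i, P i) = Set.univ ∧ ∀ i, ∀ x ∈ P i, g x = α (γ i) x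

/-- `⟦α⟧` admits a dense locally finite subgroup: there is a subgroup `Λ` of `Homeo(X)`
contained in `⟦α⟧`, locally finite (all its finitely generated subgroups are finite), and
dense in `⟦α⟧` for the topology whose basic neighborhoods of `h` are
`{g : g A = h A for all A ∈ 𝒜}`, `𝒜` ranging over finite clopen partitions of `X`. -/
def HasDenseLocallyFiniteSubgroup (α : Γ →* X ≃ₜ X) : Prop :=
  ∃ Λ : Subgroup (X ≃ₜ X),
    ((Λ : Set (X ≃ₜ X)) ⊆ {g | InTopFullGroup α g}) ∧
    (∀ s : Finset (X ≃ₜ X), (s : Set (X ≃ₜ X)) ⊆ (Λ : Set (X ≃ₜ X)) →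
      ((Subgroup.closure (s : Set (X ≃ₜ X)) : Subgroup (X ≃ₜ X)) : Set (X ≃ₜ X)).Finite) ∧
    ∀ g : X ≃ₜ X, InTopFullGroup α g →
      ∀ (n : ℕ) (P : Fin n → Set X), (∀ i, IsClopen (P i)) →
        (Pairwise fun i j => Disjoint (P i) (P j)) → (⋃ i, P i) = Set.univ →
        ∃ l ∈ Λ, ∀ i, ⇑l '' P i = ⇑g '' P i

end Defs

/-- The topology on `Homeo(X)` whose basic neighborhoods of `h` are the sets
`{g : g A = h A for all A ∈ 𝒜}`, for `𝒜` a finite clopen partition of `X`; equivalently,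
the topology generated by the sets `{g : g '' A = B}` for `A`, `B` clopen. -/
def homeoTop (X : Type*) [TopologicalSpace X] : TopologicalSpace (X ≃ₜ X) :=
  TopologicalSpace.generateFrom
    {U | ∃ A B : Set X, IsClopen A ∧ IsClopen B ∧ U = {g : X ≃ₜ X | ⇑g '' A = B}}

/-- The topology on the space `A(Γ)` of actions of `Γ` on `X`, induced from the product
topology on `Homeo(X)^Γ`. -/
def actionTop (Γ : Type*) [Group Γ] (X : Type*) [TopologicalSpace X] :
    TopologicalSpace (Γ →* (X ≃ₜ X)) :=
  letI := homeoTop X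
  TopologicalSpace.induced (fun φ : Γ →* (X ≃ₜ X) => ⇑φ) Pi.topologicalSpace


section PartA

variable {Γ : Type*} [Group Γ] {X : Type*} [TopologicalSpace X]

theorem hmul_apply (g h : X ≃ₜ X) (x : X) : (g * h) x = g (h x) := rfl
theorem hone_apply (x : X) : (1 : X ≃ₜ X) x = x := rfl
theorem hinv_apply (g : X ≃ₜ X) (x : X) : g⁻¹ x = g.symm x := rfl
theorem hinv_apply_self (g : X ≃ₜ X) (x : X) : g⁻¹ (g x) = x := g.symm_apply_apply x
theorem hself_apply_inv (g : X ≃ₜ X) (x : X) : g (g⁻¹ x) = x := g.apply_symm_apply x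

/-- combine two functions pointwise -/
def lift2 (F : ℕ → ℕ → ℕ) (f g : C(X, ℕ)) : C(X, ℕ) :=
  ⟨fun x => F (f x) (g x), (continuous_of_discreteTopology (f := fun p : ℕ × ℕ => F p.1 p.2)).comp
    (f.continuous.prodMk g.continuous)⟩

@[simp] theorem lift2_apply (F : ℕ → ℕ → ℕ) (f g : C(X, ℕ)) (x : X) :
    lift2 F f g x = F (f x) (g x) := rfl

@[simp] theorem actC_apply (α : Γ →* X ≃ₜ X) (γ : Γ) (f : C(X, ℕ)) (x : X) :
    actC α γ f x = f (α γ⁻¹ x) := rfl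

theorem actC_add (α : Γ →* X ≃ₜ X) (γ : Γ) (f g : C(X, ℕ)) :
    actC α γ (f + g) = actC α γ f + actC α γ g := rfl

theorem actC_zero (α : Γ →* X ≃ₜ X) (γ : Γ) :
    actC α γ (0 : C(X, ℕ)) = 0 := rfl

theorem actC_mul (α : Γ →* X ≃ₜ X) (γ δ : Γ) (f : C(X, ℕ)) :
    actC α (γ * δ) f = actC α γ (actC α δ f) := by
  ext x; simp

theorem actC_one (α : Γ →* X ≃ₜ X) (f : C(X, ℕ)) :
    actC α 1 f = f := by
  ext x; simp

/-- equidecomposability as a submonoid of pairs -/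
def EqD (α : Γ →* X ≃ₜ X) : AddSubmonoid (C(X, ℕ) × C(X, ℕ)) :=
  AddSubmonoid.closure {p | ∃ γ h, p = (h, actC α γ h)}

theorem EqD_gen (α : Γ →* X ≃ₜ X) (γ : Γ) (h : C(X, ℕ)) : (h, actC α γ h) ∈ EqD α :=
  AddSubmonoid.subset_closure ⟨γ, h, rfl⟩

theorem EqD_refl (α : Γ →* X ≃ₜ X) (h : C(X, ℕ)) : (h, h) ∈ EqD α := by
  have := EqD_gen α 1 h
  rwa [actC_one] at this

theorem EqD_add (α : Γ →* X ≃ₜ X) {f g f' g' : C(X, ℕ)} (h : (f, g) ∈ EqD α)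
    (h' : (f', g') ∈ EqD α) : (f + f', g + g') ∈ EqD α := (EqD α).add_mem h h'

theorem EqD_sum (α : Γ →* X ≃ₜ X) {ι : Type*} (s : Finset ι) (f g : ι → C(X, ℕ))
    (h : ∀ i ∈ s, (f i, g i) ∈ EqD α) : (∑ i ∈ s, f i, ∑ i ∈ s, g i) ∈ EqD α := by
  have := (EqD α).sum_mem h
  convert this using 1
  ext1 <;> simp [Prod.fst_sum, Prod.snd_sum]

/-- induction principle -/
theorem EqD_ind (α : Γ →* X ≃ₜ X) {P : C(X, ℕ) → C(X, ℕ) → Prop}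
    (hgen : ∀ γ h, P h (actC α γ h)) (h0 : P 0 0)
    (hadd : ∀ f g f' g', (f, g) ∈ EqD α → (f', g') ∈ EqD α → P f g → P f' g' →
      P (f + f') (g + g'))
    {f g : C(X, ℕ)} (h : (f, g) ∈ EqD α) : P f g := by
  have key : ∀ p ∈ EqD α, P p.1 p.2 := by
    intro p hp
    induction hp using AddSubmonoid.closure_induction with
    | mem x hx => obtain ⟨γ, h, rfl⟩ := hx; exact hgen γ h
    | zero => exact h0
    | add x y hx hy h1 h2 => exact hadd _ _ _ _ hx hy h1 h2
  exact key _ h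

theorem EqD_symm (α : Γ →* X ≃ₜ X) {f g : C(X, ℕ)} (h : (f, g) ∈ EqD α) : (g, f) ∈ EqD α := by
  refine EqD_ind α (P := fun f g => (g, f) ∈ EqD α) ?_ (EqD α).zero_mem ?_ h
  · intro γ h
    have := EqD_gen α γ⁻¹ (actC α γ h)
    rwa [← actC_mul, inv_mul_cancel, actC_one] at this
  · intro f g f' g' _ _ h1 h2
    exact EqD_add α h1 h2

theorem refine22 (f f' s t : C(X, ℕ)) (h : f + f' = s + t) : ∃ a b c d : C(X, ℕ),
    f = a + b ∧ f' = c + d ∧ s = a + c ∧ t = b + d := by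
  refine ⟨lift2 min f s, lift2 (fun m n => m - min m n) f s, lift2 (fun m n => n - min m n) f s,
    lift2 (fun m n => m - n) f' (lift2 (fun m n => n - min m n) f s), ?_, ?_, ?_, ?_⟩ <;>
  · ext x
    have := DFunLike.congr_fun h x
    simp only [ContinuousMap.add_apply, lift2_apply] at this ⊢
    omega

theorem EqD_split (α : Γ →* X ≃ₜ X) {f g : C(X, ℕ)} (h : (f, g) ∈ EqD α) :
    ∀ f1 f2, f = f1 + f2 → ∃ g1 g2, g = g1 + g2 ∧ (f1, g1) ∈ EqD α ∧ (f2, g2) ∈ EqD α := by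
  refine EqD_ind α (P := fun f g => ∀ f1 f2, f = f1 + f2 → ∃ g1 g2, g = g1 + g2 ∧
    (f1, g1) ∈ EqD α ∧ (f2, g2) ∈ EqD α) ?_ ?_ ?_ h
  · rintro γ h f1 f2 rfl
    exact ⟨_, _, actC_add α γ f1 f2, EqD_gen _ _ _, EqD_gen _ _ _⟩
  · intro f1 f2 h
    have h1 : f1 = 0 := by
      ext x; have := DFunLike.congr_fun h x; simp at this ⊢; omega
    have h2 : f2 = 0 := by
      ext x; have := DFunLike.congr_fun h x; simp at this ⊢; omega
    exact ⟨0, 0, by simp, by rw [h1]; exact (EqD α).zero_mem, by rw [h2]; exact (EqD α).zero_mem⟩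
  · intro f g f' g' _ _ ih1 ih2 s t hst
    obtain ⟨a, b, c, d, rfl, rfl, rfl, rfl⟩ := refine22 _ _ _ _ hst
    obtain ⟨g1, g2, rfl, h1, h2⟩ := ih1 a b rfl
    obtain ⟨g3, g4, rfl, h3, h4⟩ := ih2 c d rfl
    exact ⟨g1 + g3, g2 + g4, by abel, EqD_add α h1 h3, EqD_add α h2 h4⟩

theorem EqD_split_sum (α : Γ →* X ≃ₜ X) {ι : Type*} (s : Finset ι) (f : ι → C(X, ℕ)) :
    ∀ g : C(X, ℕ), (∑ i ∈ s, f i, g) ∈ EqD α →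
    ∃ g' : ι → C(X, ℕ), g = ∑ i ∈ s, g' i ∧ ∀ i ∈ s, (f i, g' i) ∈ EqD α := by
  classical
  induction s using Finset.induction_on with
  | empty =>
    intro g h
    obtain ⟨g1, g2, hg, h1, h2⟩ := EqD_split α (EqD_symm α h) g 0 (by simp)
    refine ⟨fun _ => 0, ?_, by simp⟩
    have : ∀ f g : C(X, ℕ), (f, g) ∈ EqD α → f = 0 → g = 0 := by
      intro f g h
      refine EqD_ind α (P := fun f g => f = 0 → g = 0) ?_ ?_ ?_ h
      · rintro γ h rfl; rfl
      · simp
      · intro f g f' g' _ _ h1 h2 h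
        have e1 : f = 0 := by
          ext x; have := DFunLike.congr_fun h x; simp at this ⊢; omega
        have e2 : f' = 0 := by
          ext x; have := DFunLike.congr_fun h x; simp at this ⊢; omega
        rw [h1 e1, h2 e2, add_zero]
    simp at h ⊢
    exact this _ _ h rfl
  | insert i s hi ih =>
    intro g h
    rw [Finset.sum_insert hi] at h
    obtain ⟨g1, g2, rfl, h1, h2⟩ := EqD_split α h _ _ rfl
    obtain ⟨g', rfl, hg'⟩ := ih g2 h2
    refine ⟨fun j => if j = i then g1 else g' j, ?_, ?_⟩
    · rw [Finset.sum_insert hi, if_pos rfl]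
      congr 1
      refine Finset.sum_congr rfl fun j hj => ?_
      rw [if_neg]; rintro rfl; exact hi hj
    · intro j hj
      by_cases hji : j = i
      · subst hji; simpa using h1
      · simp only [hji, if_false]
        exact hg' j ((Finset.mem_insert.1 hj).resolve_left hji)

theorem EqD_act (α : Γ →* X ≃ₜ X) (γ : Γ) {f g : C(X, ℕ)} (h : (f, g) ∈ EqD α) :
    (actC α γ f, g) ∈ EqD α := by
  refine EqD_ind α (P := fun f g => (actC α γ f, g) ∈ EqD α) ?_ (EqD α).zero_mem ?_ h
  · intro δ h
    have := EqD_gen α (δ * γ⁻¹) (actC α γ h)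
    rwa [← actC_mul, inv_mul_cancel_right] at this
  · intro f g f' g' _ _ h1 h2
    exact EqD_add α h1 h2

theorem EqD_trans (α : Γ →* X ≃ₜ X) {f g k : C(X, ℕ)} (h : (f, g) ∈ EqD α) (h' : (g, k) ∈ EqD α) :
    (f, k) ∈ EqD α := by
  refine EqD_ind α (P := fun f g => ∀ k, (g, k) ∈ EqD α → (f, k) ∈ EqD α) ?_ ?_ ?_ h k h'
  · intro γ h k hk
    have := EqD_act α γ⁻¹ hk
    rwa [← actC_mul, inv_mul_cancel, actC_one] at this
  · simp
  · intro f g f' g' _ _ h1 h2 k hk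
    obtain ⟨k1, k2, rfl, h3, h4⟩ := EqD_split α hk _ _ rfl
    exact EqD_add α (h1 _ h3) (h2 _ h4)

theorem EqD_zero (α : Γ →* X ≃ₜ X) {g : C(X, ℕ)} (h : (0, g) ∈ EqD α) : g = 0 := by
  obtain ⟨g', h, -⟩ := EqD_split_sum α (∅ : Finset ℕ) (fun _ => 0) g (by simpa using h)
  simpa using h

/-- the congruence -/
def EqDCon (α : Γ →* X ≃ₜ X) : AddCon C(X, ℕ) where
  r f g := (f, g) ∈ EqD α
  iseqv := ⟨EqD_refl α, EqD_symm α, EqD_trans α⟩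
  add' h h' := EqD_add α h h'

theorem typeCon_iff (α : Γ →* X ≃ₜ X) (f g : C(X, ℕ)) : typeCon α f g ↔ (f, g) ∈ EqD α := by
  constructor
  · intro h
    have : typeCon α ≤ EqDCon α := by
      unfold typeCon
      rw [AddCon.addConGen_le]
      rintro f g ⟨n, h, γ, rfl, rfl⟩
      exact EqD_sum α _ _ _ fun i _ => EqD_gen α _ _
    exact this h
  · intro h
    refine EqD_ind α (P := fun f g => typeCon α f g) ?_ ((typeCon α).refl 0) ?_ h
    · intro γ h
      refine AddConGen.Rel.of _ _ ⟨1, fun _ => h, fun _ => γ, by simp, by simp⟩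
    · intro f g f' g' _ _ h1 h2
      exact (typeCon α).add h1 h2

theorem cls_eq (α : Γ →* X ≃ₜ X) (f g : C(X, ℕ)) : cls α f = cls α g ↔ (f, g) ∈ EqD α := by
  rw [← typeCon_iff]
  exact AddCon.eq _

theorem cls_add (α : Γ →* X ≃ₜ X) (f g : C(X, ℕ)) : cls α (f + g) = cls α f + cls α g := rfl

theorem cls_zero (α : Γ →* X ≃ₜ X) : cls α (0 : C(X, ℕ)) = 0 := rfl

/-- class map as hom -/
def clsHom (α : Γ →* X ≃ₜ X) : C(X, ℕ) →+ TypeSemigroup α where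
  toFun := cls α
  map_zero' := rfl
  map_add' _ _ := rfl

theorem cls_sum (α : Γ →* X ≃ₜ X) {ι : Type*} (s : Finset ι) (f : ι → C(X, ℕ)) :
    cls α (∑ i ∈ s, f i) = ∑ i ∈ s, cls α (f i) := map_sum (clsHom α) f s

theorem cls_nsmul (α : Γ →* X ≃ₜ X) (n : ℕ) (f : C(X, ℕ)) :
    cls α (n • f) = n • cls α f := map_nsmul (clsHom α) n f

theorem cls_surj (α : Γ →* X ≃ₜ X) (a : TypeSemigroup α) : ∃ f, cls α f = a :=
  AddCon.induction_on a fun f => ⟨f, rfl⟩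

end PartA

section PartB

variable {Γ : Type*} [Group Γ] {X : Type*} [TopologicalSpace X]

open Classical in
/-- indicator of a clopen set -/
noncomputable def ind (A : Set X) (hA : IsClopen A) : C(X, ℕ) :=
  ⟨fun x => if x ∈ A then 1 else 0, by
    refine continuous_const.if ?_ continuous_const
    intro a ha
    rw [show {x | x ∈ A} = A from rfl, hA.frontier_eq] at ha
    exact absurd ha (by simp)⟩

open Classical in
@[simp] theorem ind_apply (A : Set X) (hA : IsClopen A) (x : X) :
    ind A hA x = if x ∈ A then 1 else 0 := rfl

theorem full_EqD (α : Γ →* X ≃ₜ X) (g : X ≃ₜ X) (hg : InTopFullGroup α g) (f : C(X, ℕ)) :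
    (f, f.comp (g⁻¹ : X ≃ₜ X)) ∈ EqD α := by
  obtain ⟨n, P, γ, hP, hd, hu, h⟩ := hg
  have key : ∀ x, ∃ i, x ∈ P i := fun x => by
    have : x ∈ ⋃ i, P i := hu ▸ Set.mem_univ x
    simpa using this
  have hd' : ∀ i j x, x ∈ P i → x ∈ P j → i = j := by
    intro i j x hi hj
    by_contra hij
    exact Set.disjoint_left.1 (hd hij) hi hj
  have e1 : f = ∑ i, f * ind (P i) (hP i) := by
    ext x
    obtain ⟨i, hi⟩ := key x
    rw [ContinuousMap.sum_apply, Finset.sum_eq_single i]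
    · simp [hi]
    · intro j _ hj
      have : x ∉ P j := fun h' => hj (hd' _ _ _ h' hi)
      simp [this]
    · simp
  have e2 : f.comp (g⁻¹ : X ≃ₜ X) = ∑ i, actC α (γ i) (f * ind (P i) (hP i)) := by
    ext y
    obtain ⟨x, rfl⟩ := g.surjective y
    obtain ⟨i, hi⟩ := key x
    rw [ContinuousMap.sum_apply, Finset.sum_eq_single i]
    · rw [h i x hi]
      have : α (γ i)⁻¹ (α (γ i) x) = x := by
        rw [map_inv]; exact hinv_apply_self _ _
      rw [actC_apply, this, ← h i x hi]
      simp [hi]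
    · intro j _ hj
      have : α (γ j)⁻¹ (g x) ∉ P j := by
        intro h'
        have h2 := h j _ h'
        rw [map_inv, hself_apply_inv] at h2
        have := g.injective h2
        rw [map_inv, this] at h'
        exact hj (hd' _ _ _ h' hi)
      simp only [actC_apply, ContinuousMap.mul_apply, ind_apply, this, if_false, mul_zero]
    · simp
  have := EqD_sum α Finset.univ (fun i => f * ind (P i) (hP i))
    (fun i => actC α (γ i) (f * ind (P i) (hP i))) (fun i _ => EqD_gen _ _ _)
  rwa [← e1, ← e2] at this

theorem exists_bound [CompactSpace X] (f : C(X, ℕ)) : ∃ N, ∀ x, f x < N := by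
  have := (isCompact_range f.continuous).finite_of_discrete
  obtain ⟨N, hN⟩ := this.bddAbove
  exact ⟨N + 1, fun x => Nat.lt_succ_of_le (hN ⟨x, rfl⟩)⟩

/-- partial sums over a finite set of homeos -/
theorem EqD_fin {Λ : Subgroup (X ≃ₜ X)} {f g : C(X, ℕ)} (h : (f, g) ∈ EqD Λ.subtype) :
    ∃ s : Finset (X ≃ₜ X), (s : Set (X ≃ₜ X)) ⊆ Λ ∧ ∀ F : Finset (X ≃ₜ X),
      (∀ l ∈ s, ∀ φ ∈ F, φ * l ∈ F) → ∀ x, ∑ φ ∈ F, f (φ⁻¹ x) = ∑ φ ∈ F, g (φ⁻¹ x) := by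
  classical
  refine EqD_ind Λ.subtype (P := fun f g => ∃ s : Finset (X ≃ₜ X), (s : Set (X ≃ₜ X)) ⊆ Λ ∧
    ∀ F : Finset (X ≃ₜ X), (∀ l ∈ s, ∀ φ ∈ F, φ * l ∈ F) →
    ∀ x, ∑ φ ∈ F, f (φ⁻¹ x) = ∑ φ ∈ F, g (φ⁻¹ x)) ?_ ?_ ?_ h
  · intro γ h
    refine ⟨{(γ : X ≃ₜ X)}, by simp, fun F hF x => ?_⟩
    have e : F.map (mulRightEmbedding (γ : X ≃ₜ X)) = F := by
      refine Finset.eq_of_subset_of_card_le ?_ (by simp)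
      intro y hy
      simp only [Finset.mem_map, mulRightEmbedding_apply] at hy
      obtain ⟨φ, hφ, rfl⟩ := hy
      exact hF _ (by simp) _ hφ
    conv_lhs => rw [← e]
    rw [Finset.sum_map]
    refine Finset.sum_congr rfl fun φ _ => ?_
    rw [actC_apply, mulRightEmbedding_apply, mul_inv_rev]
    rfl
  · exact ⟨∅, by simp, fun F _ x => rfl⟩
  · rintro f g f' g' - - ⟨s, hs, h1⟩ ⟨t, ht, h2⟩
    refine ⟨s ∪ t, by simp [hs, ht], fun F hF x => ?_⟩
    simp only [ContinuousMap.add_apply, Finset.sum_add_distrib]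
    rw [h1 F (fun l hl => hF l (Finset.mem_union_left _ hl)),
      h2 F (fun l hl => hF l (Finset.mem_union_right _ hl))]

theorem greedy (α : Γ →* X ≃ₜ X) (L : Finset Γ) (f g : C(X, ℕ)) :
    ∃ f' g' k k' : C(X, ℕ), f = k + f' ∧ g = k' + g' ∧ (k, k') ∈ EqD α ∧
      ∀ γ ∈ L, ∀ x, f' x = 0 ∨ g' (α γ x) = 0 := by
  classical
  induction L using Finset.induction_on with
  | empty => exact ⟨f, g, 0, 0, by simp, by simp, (EqD α).zero_mem, by simp⟩
  | insert γ L hγ ih =>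
    obtain ⟨f', g', k, k', rfl, rfl, hk, h⟩ := ih
    let m : C(X, ℕ) := lift2 min f' (g'.comp (α γ))
    have hm : ∀ x, m x = min (f' x) (g' (α γ x)) := fun x => rfl
    have hm' : ∀ y, actC α γ m y = min (f' (α γ⁻¹ y)) (g' y) := fun y => by
      rw [actC_apply, hm, map_inv, hself_apply_inv]
    refine ⟨lift2 (· - ·) f' m, lift2 (· - ·) g' (actC α γ m), k + m, k' + actC α γ m,
      ?_, ?_, EqD_add α hk (EqD_gen _ _ _), ?_⟩
    · ext x; simp only [ContinuousMap.add_apply, lift2_apply, hm]; omega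
    · ext x; simp only [ContinuousMap.add_apply, lift2_apply, hm']; omega
    · intro δ hδ x
      rw [Finset.mem_insert] at hδ
      rcases hδ with rfl | hδ
      · simp only [lift2_apply, hm, hm']
        rw [map_inv, hinv_apply_self]
        omega
      · rcases h δ hδ x with h | h
        · left; simp [h]
        · right; simp [h]

theorem EqD_mono {F Λ : Subgroup (X ≃ₜ X)} (hFL : F ≤ Λ) {f g : C(X, ℕ)}
    (h : (f, g) ∈ EqD F.subtype) : (f, g) ∈ EqD Λ.subtype := by
  refine EqD_ind F.subtype (P := fun f g => (f, g) ∈ EqD Λ.subtype) ?_ (AddSubmonoid.zero_mem _)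
    ?_ h
  · intro γ h
    exact EqD_gen Λ.subtype ⟨γ, hFL γ.2⟩ h
  · intro f g f' g' _ _ h1 h2
    exact EqD_add _ h1 h2

theorem forward_key {Λ : Subgroup (X ≃ₜ X)} (F : Subgroup (X ≃ₜ X)) (hF : (F : Set (X ≃ₜ X)).Finite)
    (hFL : F ≤ Λ) (f g : C(X, ℕ))
    (h : ∀ x, ∑ φ ∈ hF.toFinset, f (φ⁻¹ x) ≤ ∑ φ ∈ hF.toFinset, g (φ⁻¹ x)) :
    ∃ c, (f + c, g) ∈ EqD Λ.subtype ∧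
      ((∀ x, ∑ φ ∈ hF.toFinset, f (φ⁻¹ x) = ∑ φ ∈ hF.toFinset, g (φ⁻¹ x)) → c = 0) := by
  classical
  have hfin : (Set.univ : Set F).Finite :=
    have : Finite F := hF
    Set.finite_univ
  obtain ⟨f', g', k, k', rfl, rfl, hk, hL⟩ := greedy F.subtype hfin.toFinset f g
  have hkk : ∀ x, ∑ φ ∈ hF.toFinset, k (φ⁻¹ x) = ∑ φ ∈ hF.toFinset, k' (φ⁻¹ x) := by
    obtain ⟨s, hs, hs'⟩ := EqD_fin hk
    refine hs' _ fun l hl φ hφ => ?_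
    simp only [Set.Finite.mem_toFinset, SetLike.mem_coe] at hφ ⊢
    exact F.mul_mem hφ (hs hl)
  replace hk : (k, k') ∈ EqD Λ.subtype := EqD_mono hFL hk
  have hL' : ∀ φ ∈ F, ∀ x, f' x = 0 ∨ g' (φ x) = 0 := fun φ hφ x =>
    hL ⟨φ, hφ⟩ (by simp) x
  have hf' : f' = 0 := by
    ext x
    by_contra hx
    have h1 : ∑ φ ∈ hF.toFinset, g' (φ⁻¹ x) = 0 :=
      Finset.sum_eq_zero fun φ hφ =>
        (hL' φ⁻¹ (F.inv_mem (by simpa using hφ)) x).resolve_left hx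
    have h2 := h x
    simp only [ContinuousMap.add_apply, Finset.sum_add_distrib, hkk, h1] at h2
    have h3 : f' ((1 : X ≃ₜ X)⁻¹ x) ≤ ∑ φ ∈ hF.toFinset, f' (φ⁻¹ x) :=
      Finset.single_le_sum (f := fun φ : X ≃ₜ X => f' (φ⁻¹ x)) (fun _ _ => Nat.zero_le _)
        (by simp [F.one_mem])
    rw [inv_one, hone_apply] at h3
    have : f' x ≠ 0 := hx
    omega
  subst hf'
  refine ⟨g', ?_, ?_⟩
  · rw [add_zero]; exact EqD_add _ hk (EqD_refl _ _)
  · intro he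
    ext x
    have h2 := he x
    simp only [ContinuousMap.add_apply, Finset.sum_add_distrib, hkk,
      ContinuousMap.zero_apply, Finset.sum_const_zero] at h2
    have h3 : g' ((1 : X ≃ₜ X)⁻¹ x) ≤ ∑ φ ∈ hF.toFinset, g' (φ⁻¹ x) :=
      Finset.single_le_sum (f := fun φ : X ≃ₜ X => g' (φ⁻¹ x)) (fun _ _ => Nat.zero_le _)
        (by simp [F.one_mem])
    rw [inv_one, hone_apply] at h3
    rw [ContinuousMap.zero_apply]
    omega

theorem forward_key' {Λ : Subgroup (X ≃ₜ X)}
    (hΛ : ∀ s : Finset (X ≃ₜ X), (s : Set (X ≃ₜ X)) ⊆ (Λ : Set (X ≃ₜ X)) →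
      ((Subgroup.closure (s : Set (X ≃ₜ X)) : Subgroup (X ≃ₜ X)) : Set (X ≃ₜ X)).Finite)
    {f g : C(X, ℕ)} (h : (f, g) ∈ EqD Λ.subtype) :
    ∃ F : Subgroup (X ≃ₜ X), ∃ hF : (F : Set (X ≃ₜ X)).Finite, F ≤ Λ ∧
      ∀ x, ∑ φ ∈ hF.toFinset, f (φ⁻¹ x) = ∑ φ ∈ hF.toFinset, g (φ⁻¹ x) := by
  obtain ⟨s, hs, h⟩ := EqD_fin h
  refine ⟨_, hΛ s hs, (Subgroup.closure_le _).2 hs, h _ ?_⟩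
  intro l hl φ hφ
  simp only [Set.Finite.mem_toFinset, SetLike.mem_coe] at hφ ⊢
  exact Subgroup.mul_mem _ hφ (Subgroup.subset_closure hl)

theorem forward [CompactSpace X] (α : Γ →* X ≃ₜ X) (h : HasDenseLocallyFiniteSubgroup α) :
    IsUnperforated α ∧ IsCancellative α := by
  obtain ⟨Λ, hΛα, hΛ, hdense⟩ := h
  have hE : ∀ f g, (f, g) ∈ EqD α ↔ (f, g) ∈ EqD Λ.subtype := by
    intro f g
    constructor
    · intro h
      refine EqD_ind α (P := fun f g => (f, g) ∈ EqD Λ.subtype) ?_ (AddSubmonoid.zero_mem _) ?_ h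
      · intro γ h
        obtain ⟨N, hN⟩ := exists_bound h
        obtain ⟨l, hl, hl'⟩ := hdense (α γ)
          ⟨1, fun _ => Set.univ, fun _ => γ, fun _ => isClopen_univ,
            fun i j hij => absurd (Subsingleton.elim i j) hij, Set.iUnion_const _, fun i x _ => rfl⟩
          N (fun i => h ⁻¹' {(i : ℕ)}) (fun i => (isClopen_discrete _).preimage h.continuous)
          (fun i j hij => by
            refine Set.disjoint_left.2 fun x hx hx' => hij (Fin.ext ?_)
            simp only [Set.mem_preimage, Set.mem_singleton_iff] at hx hx'
            omega)
          (by
            ext x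
            simp only [Set.mem_iUnion, Set.mem_preimage, Set.mem_singleton_iff, Set.mem_univ,
              iff_true]
            exact ⟨⟨h x, hN x⟩, rfl⟩)
        have : actC α γ h = actC Λ.subtype ⟨l, hl⟩ h := by
          ext y
          obtain ⟨x, rfl⟩ := (α γ).surjective y
          have h1 : α γ x ∈ l '' (h ⁻¹' {((⟨h x, hN x⟩ : Fin N) : ℕ)}) := by
            rw [hl']; exact ⟨x, rfl, rfl⟩
          obtain ⟨z, hz, hz'⟩ := h1
          rw [actC_apply, map_inv, hinv_apply_self, actC_apply, map_inv, ← hz']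
          exact (hz : h z = h x).symm.trans (congrArg h (hinv_apply_self l z).symm)
        rw [this]
        exact EqD_gen _ _ _
      · intro f g f' g' _ _ h1 h2
        exact EqD_add _ h1 h2
    · intro h
      refine EqD_ind Λ.subtype (P := fun f g => (f, g) ∈ EqD α) ?_ (AddSubmonoid.zero_mem _) ?_ h
      · intro l h
        exact full_EqD α l (hΛα l.2) h
      · intro f g f' g' _ _ h1 h2
        exact EqD_add _ h1 h2
  constructor
  · rintro a b n hn ⟨c, hc⟩
    obtain ⟨f, rfl⟩ := cls_surj α a
    obtain ⟨g, rfl⟩ := cls_surj α b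
    obtain ⟨k, rfl⟩ := cls_surj α c
    rw [← cls_nsmul, ← cls_nsmul, ← cls_add, cls_eq, hE] at hc
    obtain ⟨F, hF, hFL, h⟩ := forward_key' hΛ hc
    obtain ⟨d, hd, -⟩ := forward_key F hF hFL f g (by
      intro x
      have := h x
      simp only [ContinuousMap.add_apply, ContinuousMap.smul_apply, Finset.sum_add_distrib,
        smul_eq_mul, ← Finset.mul_sum] at this
      refine Nat.le_of_mul_le_mul_left (c := n) ?_ hn
      omega)
    exact ⟨cls α d, by rw [← cls_add, cls_eq, hE]; exact hd⟩
  · rintro a b c hc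
    obtain ⟨f, rfl⟩ := cls_surj α a
    obtain ⟨g, rfl⟩ := cls_surj α b
    obtain ⟨k, rfl⟩ := cls_surj α c
    rw [← cls_add, ← cls_add, cls_eq, hE] at hc
    obtain ⟨F, hF, hFL, h⟩ := forward_key' hΛ hc
    have h' : ∀ x, ∑ φ ∈ hF.toFinset, g (φ⁻¹ x) = ∑ φ ∈ hF.toFinset, k (φ⁻¹ x) := by
      intro x
      have := h x
      simp only [ContinuousMap.add_apply, Finset.sum_add_distrib] at this
      omega
    obtain ⟨d, hd, hd'⟩ := forward_key F hF hFL g k (fun x => (h' x).le)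
    rw [hd' h', add_zero] at hd
    rwa [cls_eq, hE]

end PartB

section PartC

/-- Riesz decomposition -/
theorem riesz {T : Type*} [AddCommMonoid T]
    (hcon : ∀ a b : T, a + b = 0 → a = 0)
    (href : ∀ a b c d : T, a + b = c + d → ∃ x y z w, a = x + y ∧ b = z + w ∧ c = x + z ∧ d = y + w)
    {ι : Type} (s : Finset ι) (y : ι → T) : ∀ x c : T, x + c = ∑ j ∈ s, y j →
    ∃ z w : ι → T, x = ∑ j ∈ s, z j ∧ ∀ j ∈ s, y j = z j + w j := by
  classical
  induction s using Finset.induction_on with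
  | empty =>
    intro x c h
    exact ⟨fun _ => 0, fun _ => 0, by simpa using hcon x c (by simpa using h), by simp⟩
  | insert i s hi ih =>
    intro x c h
    rw [Finset.sum_insert hi] at h
    obtain ⟨p, q, r, t, rfl, rfl, h1, h2⟩ := href _ _ _ _ h
    obtain ⟨z, w, rfl, hz⟩ := ih q t h2.symm
    refine ⟨Function.update z i p, Function.update w i r, ?_, ?_⟩
    · rw [Finset.sum_insert hi, Function.update_self, Finset.sum_update_of_notMem hi]
    · intro j hj
      by_cases hji : j = i
      · subst hji; simpa using h1
      · rw [Function.update_of_ne hji, Function.update_of_ne hji]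
        exact hz j ((Finset.mem_insert.1 hj).resolve_left hji)

theorem push_sum {T : Type*} [AddCommMonoid T] {ι κ : Type} [Fintype ι] [Fintype κ]
    (a : ι → T) (b : κ → T) (m : ι → κ → ℕ) (h : ∀ i, a i = ∑ k, m i k • b k) (p : ι → ℕ) :
    ∑ i, p i • a i = ∑ k, (∑ i, p i * m i k) • b k := by
  simp_rw [h, Finset.smul_sum, Finset.sum_smul, mul_smul]
  rw [Finset.sum_comm]

/-- the conclusion of Shen's property for one relation -/
def ShenC {T : Type*} [AddCommMonoid T] {ι : Type} [Fintype ι] (a : ι → T) (p q : ι → ℕ) : Prop :=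
  ∃ (κ : Type) (_ : Fintype κ) (b : κ → T) (m : ι → κ → ℕ),
    (∀ i, a i = ∑ k, m i k • b k) ∧ ∀ k, ∑ i, p i * m i k = ∑ i, q i * m i k

theorem ShenC_symm {T : Type*} [AddCommMonoid T] {ι : Type} [Fintype ι] (a : ι → T) (p q : ι → ℕ)
    (h : ShenC a p q) : ShenC a q p := by
  obtain ⟨κ, _, b, m, h1, h2⟩ := h
  exact ⟨κ, _, b, m, h1, fun k => (h2 k).symm⟩

theorem ShenC_push {T : Type*} [AddCommMonoid T] {ι κ : Type} [Fintype ι] [Fintype κ]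
    (a : ι → T) (b : κ → T) (m : ι → κ → ℕ) (h : ∀ i, a i = ∑ k, m i k • b k) (p q : ι → ℕ)
    (p' q' r : κ → ℕ) (hp : ∀ k, ∑ i, p i * m i k = p' k + r k)
    (hq : ∀ k, ∑ i, q i * m i k = q' k + r k) (hb : ShenC b p' q') : ShenC a p q := by
  obtain ⟨μ, _, c, m', h1, h2⟩ := hb
  refine ⟨μ, inferInstance, c, fun i l => ∑ k, m i k * m' k l, ?_, ?_⟩
  · intro i
    rw [h i, push_sum b c m' h1]
  · intro l
    have key : ∀ p : ι → ℕ, ∑ i, p i * ∑ k, m i k * m' k l = ∑ k, (∑ i, p i * m i k) * m' k l := by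
      intro p
      simp_rw [Finset.mul_sum, Finset.sum_mul]
      rw [Finset.sum_comm]
      simp_rw [mul_assoc]
    rw [key, key]
    simp_rw [hp, hq, add_mul, Finset.sum_add_distrib, h2]

/-- one reduction step -/
theorem shen_step {T : Type*} [AddCommMonoid T]
    (hcan : ∀ a b c : T, a + b = a + c → b = c)
    (hcon : ∀ a b : T, a + b = 0 → a = 0)
    (href : ∀ a b c d : T, a + b = c + d → ∃ x y z w, a = x + y ∧ b = z + w ∧ c = x + z ∧ d = y + w)
    (hunp : ∀ (a b c : T) (n : ℕ), 1 ≤ n → n • a + c = n • b → ∃ d, a + d = b)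
    {ι : Type} [Fintype ι] (a : ι → T) (p q : ι → ℕ) (M : ℕ) (hM : 1 ≤ M)
    (hpM : ∀ i, p i ≤ M) (hqM : ∀ i, q i ≤ M) (hpq : ∀ i, p i = 0 ∨ q i = 0)
    (hrel : ∑ i, p i • a i = ∑ i, q i • a i) (i0 : ι) (hi0 : p i0 = M) :
    ∃ (κ : Type) (_ : Fintype κ) (b : κ → T) (p' q' : κ → ℕ),
      (∀ i, p' i ≤ M) ∧ (∀ i, q' i ≤ M) ∧ (∀ i, p' i = 0 ∨ q' i = 0) ∧
      ∑ i, p' i • b i = ∑ i, q' i • b i ∧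
      (Finset.univ.filter fun k => p' k = M).card + (Finset.univ.filter fun k => q' k = M).card <
      (Finset.univ.filter fun k => p k = M).card + (Finset.univ.filter fun k => q k = M).card ∧
      (ShenC b p' q' → ShenC a p q) := by
  classical
  set J : Finset ι := Finset.univ.filter fun j => 0 < q j with hJ
  have hi0J : i0 ∉ J := by
    simp only [hJ, Finset.mem_filter, Finset.mem_univ, true_and]
    rcases hpq i0 with h | h <;> omega
  obtain ⟨d, hd⟩ : ∃ d, a i0 + d = ∑ j ∈ J, a j := by
    refine hunp _ _ (∑ i ∈ Finset.univ.erase i0, p i • a i + ∑ j ∈ J, (M - q j) • a j) M hM ?_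
    rw [← add_assoc]
    conv_lhs => rw [← hi0]
    rw [Finset.add_sum_erase _ (fun i => p i • a i) (Finset.mem_univ i0), hrel, hi0]
    have : ∑ i, q i • a i = ∑ j ∈ J, q j • a j := by
      symm
      refine Finset.sum_subset (Finset.subset_univ _) fun j _ hj => ?_
      have : q j = 0 := by simpa [hJ] using hj
      simp [this]
    rw [this, ← Finset.sum_add_distrib, Finset.smul_sum]
    refine Finset.sum_congr rfl fun j _ => ?_
    rw [← add_smul, Nat.add_sub_cancel' (hqM j)]
  obtain ⟨z, w, hz, hzw⟩ := riesz hcon href J a _ _ hd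
  let b : ι ⊕ ι → T := Sum.elim (fun i => if i ∈ J then w i else a i) z
  let m : ι → ι ⊕ ι → ℕ := fun i => Sum.elim (fun i' => if i = i' ∧ i ≠ i0 then 1 else 0)
    (fun j => if j ∈ J ∧ (i = i0 ∨ i = j) then 1 else 0)
  let p' : ι ⊕ ι → ℕ := Sum.elim (fun i => if i = i0 then 0 else p i)
    (fun j => if j ∈ J then M - q j else 0)
  let q' : ι ⊕ ι → ℕ := Sum.elim (fun i => if i = i0 then 0 else q i) (fun _ => 0)
  let r : ι ⊕ ι → ℕ := Sum.elim (fun i => 0) (fun j => if j ∈ J then q j else 0)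
  have hJp : ∀ j ∈ J, p j = 0 ∧ q i0 = 0 ∧ j ≠ i0 := by
    intro j hj
    have h1 : 0 < q j := by simpa [hJ] using hj
    refine ⟨by rcases hpq j with h | h <;> omega, by rcases hpq i0 with h | h <;> omega, ?_⟩
    rintro rfl; exact hi0J hj
  have hab : ∀ i, a i = ∑ k, m i k • b k := by
    intro i
    rw [Fintype.sum_sum_type]
    simp only [m, b, Sum.elim_inl, Sum.elim_inr, ite_smul, one_smul, zero_smul]
    by_cases hi : i = i0
    · subst hi
      simp [hz, Finset.sum_ite_mem]
    · have e1 : (∑ x, if i = x ∧ i ≠ i0 then (if x ∈ J then w x else a x) else 0) =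
          if i ∈ J then w i else a i := by
        rw [Finset.sum_eq_single i]
        · simp [hi]
        · intro j _ hj; rw [if_neg]; rintro ⟨rfl, -⟩; exact hj rfl
        · simp
      have e2 : (∑ x, if x ∈ J ∧ (i = i0 ∨ i = x) then z x else 0) = if i ∈ J then z i else 0 := by
        rw [Finset.sum_eq_single i]
        · simp
        · intro j _ hj; rw [if_neg]; rintro ⟨-, h | h⟩
          · exact hi h
          · exact hj h.symm
        · simp
      rw [e1, e2]
      by_cases hiJ : i ∈ J
      · simp only [hiJ, if_true]; rw [hzw i hiJ, add_comm]
      · simp [hiJ]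
  have hcol : ∀ (s : ι → ℕ) (k : ι ⊕ ι), ∑ i, s i * m i k =
      Sum.elim (fun i => if i = i0 then 0 else s i) (fun j => if j ∈ J then s i0 + s j else 0) k := by
    intro s k
    rcases k with i | j
    · simp only [m, Sum.elim_inl]
      rw [Finset.sum_eq_single i]
      · by_cases h : i = i0 <;> simp [h]
      · intro j _ hj; rw [if_neg, mul_zero]; rintro ⟨rfl, -⟩; exact hj rfl
      · simp
    · simp only [m, Sum.elim_inr]
      by_cases hj : j ∈ J
      · simp only [hj, true_and, if_true]
        have hne := (hJp j hj).2.2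
        rw [← Finset.sum_subset (Finset.subset_univ {i0, j}), Finset.sum_pair hne.symm]
        · simp
        · intro x _ hx
          rw [if_neg, mul_zero]
          simpa using hx
      · simp [hj]
  have hp : ∀ k, ∑ i, p i * m i k = p' k + r k := by
    intro k
    rw [hcol]
    rcases k with i | j
    · simp [p', r]
    · simp only [p', r, Sum.elim_inr]
      split_ifs with hj
      · have := hJp j hj
        have := hqM j
        omega
      · rfl
  have hq : ∀ k, ∑ i, q i * m i k = q' k + r k := by
    intro k
    rw [hcol]
    rcases k with i | j
    · simp [q', r]
    · simp only [q', r, Sum.elim_inr]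
      split_ifs with hj
      · have := hJp j hj
        omega
      · rfl
  refine ⟨ι ⊕ ι, inferInstance, b, p', q', ?_, ?_, ?_, ?_, ?_, ?_⟩
  · rintro (i | j) <;> simp only [p', Sum.elim_inl, Sum.elim_inr] <;> split_ifs <;>
      first | omega | exact hpM _
  · rintro (i | j) <;> simp only [q', Sum.elim_inl, Sum.elim_inr]
    · split_ifs
      · omega
      · exact hqM _
    · omega
  · rintro (i | j) <;> simp only [p', q', Sum.elim_inl, Sum.elim_inr]
    · split_ifs
      · simp
      · exact hpq i
    · simp
  · have h1 := push_sum a b m hab p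
    have h2 := push_sum a b m hab q
    rw [hrel, h2] at h1
    simp_rw [hp, hq, add_smul, Finset.sum_add_distrib] at h1
    rw [add_comm, add_comm (∑ k, p' k • b k)] at h1
    exact (hcan _ _ _ h1).symm
  · have c1 : (Finset.univ.filter fun k => p' k = M).card <
        (Finset.univ.filter fun k => p k = M).card := by
      have : (Finset.univ.filter fun k => p' k = M) ⊆
          ((Finset.univ.filter fun k => p k = M).erase i0).map ⟨Sum.inl, Sum.inl_injective⟩ := by
        rintro (i | j) hk
        · simp only [p', Finset.mem_filter, Finset.mem_univ, true_and, Sum.elim_inl] at hk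
          split_ifs at hk with h
          · omega
          · simp [h, hk]
        · simp only [p', Finset.mem_filter, Finset.mem_univ, true_and, Sum.elim_inr] at hk
          split_ifs at hk with h
          · have : 0 < q j := by simpa [hJ] using h
            omega
          · omega
      have h1 := Finset.card_le_card this
      rw [Finset.card_map] at h1
      have h2 := Finset.card_erase_lt_of_mem (s := Finset.univ.filter fun k => p k = M) (a := i0)
        (by simp [hi0])
      omega
    have c2 : (Finset.univ.filter fun k => q' k = M).card ≤
        (Finset.univ.filter fun k => q k = M).card := by
      have : (Finset.univ.filter fun k => q' k = M) ⊆
          ((Finset.univ.filter fun k => q k = M)).map ⟨Sum.inl, Sum.inl_injective⟩ := by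
        rintro (i | j) hk
        · simp only [q', Finset.mem_filter, Finset.mem_univ, true_and, Sum.elim_inl] at hk
          split_ifs at hk with h
          · omega
          · simp [hk]
        · simp only [q', Finset.mem_filter, Finset.mem_univ, true_and, Sum.elim_inr] at hk
          omega
      have h1 := Finset.card_le_card this
      rwa [Finset.card_map] at h1
    omega
  · exact ShenC_push a b m hab p q p' q' r hp hq

theorem shen_aux {T : Type*} [AddCommMonoid T]
    (hcan : ∀ a b c : T, a + b = a + c → b = c)
    (hcon : ∀ a b : T, a + b = 0 → a = 0)
    (href : ∀ a b c d : T, a + b = c + d → ∃ x y z w, a = x + y ∧ b = z + w ∧ c = x + z ∧ d = y + w)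
    (hunp : ∀ (a b c : T) (n : ℕ), 1 ≤ n → n • a + c = n • b → ∃ d, a + d = b)
    (M : ℕ) : ∀ (n : ℕ) (ι : Type) [Fintype ι] (a : ι → T) (p q : ι → ℕ),
    (∀ i, p i ≤ M) → (∀ i, q i ≤ M) → (∀ i, p i = 0 ∨ q i = 0) →
    ∑ i, p i • a i = ∑ i, q i • a i →
    (Finset.univ.filter fun k => p k = M).card + (Finset.univ.filter fun k => q k = M).card = n →
    ShenC a p q := by
  classical
  induction M with
  | zero =>
    intro n ι _ a p q hp hq _ _ _
    refine ⟨ι, inferInstance, a, fun i k => if i = k then 1 else 0, ?_, ?_⟩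
    · intro i; simp
    · intro k
      have : ∀ i, p i = q i := fun i => by
        have := hp i; have := hq i; omega
      simp_rw [this]
  | succ M ihM =>
    intro n
    induction n using Nat.strong_induction_on with
    | _ n ih =>
      intro ι _ a p q hp hq hpq hrel hn
      by_cases h1 : ∃ i0, p i0 = M + 1
      · obtain ⟨i0, hi0⟩ := h1
        obtain ⟨κ, _, b, p', q', h1, h2, h3, h4, h5, h6⟩ := shen_step hcan hcon href hunp a p q
          (M + 1) (by omega) hp hq hpq hrel i0 hi0
        exact h6 (ih _ (hn ▸ h5) κ b p' q' h1 h2 h3 h4 rfl)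
      by_cases h2 : ∃ i0, q i0 = M + 1
      · obtain ⟨i0, hi0⟩ := h2
        obtain ⟨κ, _, b, p', q', h1, h2, h3, h4, h5, h6⟩ := shen_step hcan hcon href hunp a q p
          (M + 1) (by omega) hq hp (fun i => (hpq i).symm) hrel.symm i0 hi0
        exact ShenC_symm _ _ _ (h6 (ih _ (by omega) κ b p' q' h1 h2 h3 h4 rfl))
      push Not at h1 h2
      exact ihM _ ι a p q (fun i => by have := hp i; have := h1 i; omega)
        (fun i => by have := hq i; have := h2 i; omega) hpq hrel rfl

theorem shen {T : Type*} [AddCommMonoid T]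
    (hcan : ∀ a b c : T, a + b = a + c → b = c)
    (hcon : ∀ a b : T, a + b = 0 → a = 0)
    (href : ∀ a b c d : T, a + b = c + d → ∃ x y z w, a = x + y ∧ b = z + w ∧ c = x + z ∧ d = y + w)
    (hunp : ∀ (a b c : T) (n : ℕ), 1 ≤ n → n • a + c = n • b → ∃ d, a + d = b)
    {ι : Type} [Fintype ι] (a : ι → T) (p q : ι → ℕ)
    (hrel : ∑ i, p i • a i = ∑ i, q i • a i) : ShenC a p q := by
  classical
  have h1 : ∀ i, p i = (p i - min (p i) (q i)) + min (p i) (q i) := fun i => by omega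
  have h2 : ∀ i, q i = (q i - min (p i) (q i)) + min (p i) (q i) := fun i => by omega
  have hrel' : ∑ i, (p i - min (p i) (q i)) • a i = ∑ i, (q i - min (p i) (q i)) • a i := by
    refine hcan (∑ i, min (p i) (q i) • a i) _ _ ?_
    rw [← Finset.sum_add_distrib, ← Finset.sum_add_distrib]
    simp_rw [← add_smul]
    convert hrel using 3 <;> omega
  refine ShenC_push a a (fun i k => if i = k then 1 else 0) (by intro i; simp) p q _ _
    (fun i => min (p i) (q i)) (by intro k; simp) (by intro k; simp)
    (shen_aux hcan hcon href hunp (∑ i, p i + ∑ i, q i) _ ι a (fun i => p i - min (p i) (q i))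
      (fun i => q i - min (p i) (q i)) ?_ ?_ ?_ hrel' rfl)
  · intro i
    have := Finset.single_le_sum (f := p) (fun _ _ => Nat.zero_le _) (Finset.mem_univ i)
    omega
  · intro i
    have := Finset.single_le_sum (f := q) (fun _ _ => Nat.zero_le _) (Finset.mem_univ i)
    omega
  · intro i; omega

/-- simultaneous version -/
theorem shen_multi {T : Type*} [AddCommMonoid T]
    (hcan : ∀ a b c : T, a + b = a + c → b = c)
    (hcon : ∀ a b : T, a + b = 0 → a = 0)
    (href : ∀ a b c d : T, a + b = c + d → ∃ x y z w, a = x + y ∧ b = z + w ∧ c = x + z ∧ d = y + w)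
    (hunp : ∀ (a b c : T) (n : ℕ), 1 ≤ n → n • a + c = n • b → ∃ d, a + d = b) (N : ℕ) :
    ∀ {ι : Type} [Fintype ι] (a : ι → T) (p q : ℕ → ι → ℕ),
    (∀ n < N, ∑ i, p n i • a i = ∑ i, q n i • a i) →
    ∃ (κ : Type) (_ : Fintype κ) (b : κ → T) (m : ι → κ → ℕ),
    (∀ i, a i = ∑ k, m i k • b k) ∧ ∀ n < N, ∀ k, ∑ i, p n i * m i k = ∑ i, q n i * m i k := by
  classical
  induction N with
  | zero =>
    intro ι _ a p q _
    exact ⟨ι, inferInstance, a, fun i k => if i = k then 1 else 0, by simp, by simp⟩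
  | succ N ih =>
    intro ι _ a p q h
    obtain ⟨κ, _, b, m, h1, h2⟩ := shen hcan hcon href hunp a (p N) (q N) (h N (by omega))
    obtain ⟨μ, _, c, m', h3, h4⟩ := ih b (fun n k => ∑ i, p n i * m i k)
      (fun n k => ∑ i, q n i * m i k) (by
        intro n hn
        rw [← push_sum a b m h1, ← push_sum a b m h1]
        exact h n (by omega))
    refine ⟨μ, inferInstance, c, fun i l => ∑ k, m i k * m' k l, ?_, ?_⟩
    · intro i
      rw [h1 i, push_sum b c m' h3]
    · intro n hn l
      have key : ∀ p : ι → ℕ, ∑ i, p i * ∑ k, m i k * m' k l =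
          ∑ k, (∑ i, p i * m i k) * m' k l := by
        intro p
        simp_rw [Finset.mul_sum, Finset.sum_mul]
        rw [Finset.sum_comm]
        simp_rw [mul_assoc]
      rw [key, key]
      rcases Nat.lt_succ_iff_lt_or_eq.1 hn with hn | rfl
      · exact h4 n hn l
      · simp_rw [h2]

end PartC

section PartD

open Topology

variable {Γ : Type*} [Group Γ] {X : Type*} [TopologicalSpace X]

/-- locally given by group elements -/
def Loc (α : Γ →* X ≃ₜ X) (g : X ≃ₜ X) : Prop := ∀ x, ∃ γ, ∀ᶠ y in 𝓝 x, g y = α γ y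

theorem Loc_of_full (α : Γ →* X ≃ₜ X) (g : X ≃ₜ X) (h : InTopFullGroup α g) : Loc α g := by
  obtain ⟨n, P, γ, hP, hd, hu, h⟩ := h
  intro x
  have : x ∈ ⋃ i, P i := hu ▸ Set.mem_univ x
  obtain ⟨i, hi⟩ := Set.mem_iUnion.1 this
  exact ⟨γ i, Filter.eventually_of_mem ((hP i).isOpen.mem_nhds hi) (h i)⟩

theorem full_of_Loc [CompactSpace X] [T2Space X] [TotallyDisconnectedSpace X]
    (α : Γ →* X ≃ₜ X) (g : X ≃ₜ X) (h : Loc α g) : InTopFullGroup α g := by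
  have h' : ∀ x, ∃ γ, ∃ V : Set X, IsClopen V ∧ x ∈ V ∧ ∀ y ∈ V, g y = α γ y := by
    intro x
    obtain ⟨γ, hγ⟩ := h x
    obtain ⟨U, hU, hUo, hxU⟩ := eventually_nhds_iff.1 hγ
    obtain ⟨V, hV, hxV, hVU⟩ := compact_exists_isClopen_in_isOpen hUo hxU
    exact ⟨γ, V, hV, hxV, fun y hy => hU y (hVU hy)⟩
  choose γ V hV hxV hVg using h'
  obtain ⟨t, -, ht⟩ := isCompact_univ.elim_nhds_subcover V
    (fun x _ => (hV x).isOpen.mem_nhds (hxV x))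
  let e := t.equivFin.symm
  let W : Fin t.card → Set X := fun i => V (e i)
  refine ⟨t.card, disjointed W, fun i => γ (e i), ?_, disjoint_disjointed W, ?_, ?_⟩
  · intro i
    refine disjointedRec (p := IsClopen) ?_ (hV _)
    intro t j ht
    exact ht.diff (hV _)
  · rw [iUnion_disjointed]
    ext x
    simp only [Set.mem_iUnion, Set.mem_univ, iff_true]
    have := ht (Set.mem_univ x)
    simp only [Set.mem_iUnion] at this
    obtain ⟨y, hy, hxy⟩ := this
    exact ⟨e.symm ⟨y, hy⟩, by simpa [W] using hxy⟩
  · intro i x hx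
    exact hVg _ _ (disjointed_subset W i hx)

theorem Loc_one (α : Γ →* X ≃ₜ X) : Loc α 1 := fun x => ⟨1, by simp⟩

theorem Loc_mul (α : Γ →* X ≃ₜ X) {g h : X ≃ₜ X} (hg : Loc α g) (hh : Loc α h) :
    Loc α (g * h) := by
  intro x
  obtain ⟨γ, h1⟩ := hh x
  obtain ⟨δ, h2⟩ := hg (h x)
  refine ⟨δ * γ, ?_⟩
  filter_upwards [h1, h.continuous.continuousAt.eventually h2] with y hy hy'
  rw [hmul_apply, hy', hy, map_mul, hmul_apply]

theorem Loc_inv (α : Γ →* X ≃ₜ X) {g : X ≃ₜ X} (hg : Loc α g) : Loc α g⁻¹ := by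
  intro y
  obtain ⟨γ, h1⟩ := hg (g⁻¹ y)
  refine ⟨γ⁻¹, ?_⟩
  filter_upwards [(g⁻¹ : X ≃ₜ X).continuous.continuousAt.eventually h1] with z hz
  rw [hself_apply_inv] at hz
  conv_rhs => rw [hz]
  rw [map_inv, hinv_apply_self]

theorem EqD_family (α : Γ →* X ≃ₜ X) {f g : C(X, ℕ)} (h : (f, g) ∈ EqD α) :
    ∃ (ι : Type) (_ : Fintype ι) (h : ι → C(X, ℕ)) (γ : ι → Γ),
      f = ∑ i, h i ∧ g = ∑ i, actC α (γ i) (h i) := by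
  refine EqD_ind α (P := fun f g => ∃ (ι : Type) (_ : Fintype ι) (h : ι → C(X, ℕ)) (γ : ι → Γ),
      f = ∑ i, h i ∧ g = ∑ i, actC α (γ i) (h i)) ?_ ?_ ?_ h
  · intro γ h
    exact ⟨Unit, inferInstance, fun _ => h, fun _ => γ, by simp, by simp⟩
  · exact ⟨Empty, inferInstance, fun _ => 0, fun _ => 1, by simp, by simp⟩
  · rintro _ _ _ _ - - ⟨ι, _, h, γ, rfl, rfl⟩ ⟨ι', _, h', γ', rfl, rfl⟩
    exact ⟨ι ⊕ ι', inferInstance, Sum.elim h h', Sum.elim γ γ', by simp, by simp⟩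

theorem exists_homeo (α : Γ →* X ≃ₜ X) {ι : Type} [Fintype ι] (h : ι → C(X, ℕ)) (γ : ι → Γ)
    (h1 : ∀ x, ∑ i, h i x = 1) (h2 : ∀ x, ∑ i, actC α (γ i) (h i) x = 1) :
    ∃ g : X ≃ₜ X, Loc α g ∧ ∀ i x, h i x ≠ 0 → g x = α (γ i) x := by
  classical
  have uniq : ∀ (u : ι → ℕ), ∑ i, u i = 1 → ∀ i j, u i ≠ 0 → u j ≠ 0 → i = j := by
    intro u hu i j hi hj
    by_contra hij
    have := Finset.sum_le_sum_of_subset (f := u) (Finset.subset_univ {i, j})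
    rw [Finset.sum_pair hij, hu] at this
    omega
  have ex : ∀ (u : ι → ℕ), ∑ i, u i = 1 → ∃ i, u i ≠ 0 := by
    intro u hu
    by_contra hne
    push Not at hne
    simp [hne] at hu
  choose c hc using fun x => ex _ (h1 x)
  choose c' hc' using fun x => ex _ (h2 x)
  have hcu : ∀ i x, h i x ≠ 0 → c x = i := fun i x hi => uniq _ (h1 x) _ _ (hc x) hi
  have hcu' : ∀ i x, actC α (γ i) (h i) x ≠ 0 → c' x = i := fun i x hi =>
    uniq _ (h2 x) _ _ (hc' x) hi
  have hopen : ∀ (f : C(X, ℕ)) x, f x ≠ 0 → ∀ᶠ y in 𝓝 x, f y ≠ 0 := fun f x hx =>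
    f.continuous.continuousAt.eventually_ne hx
  have hloc : ∀ x, ∀ᶠ y in 𝓝 x, α (γ (c y)) y = α (γ (c x)) y := by
    intro x
    filter_upwards [hopen _ x (hc x)] with y hy
    rw [hcu _ _ hy]
  have hloc' : ∀ x, ∀ᶠ y in 𝓝 x, α (γ (c' y))⁻¹ y = α (γ (c' x))⁻¹ y := by
    intro x
    filter_upwards [hopen _ x (hc' x)] with y hy
    rw [hcu' _ _ hy]
  let g : X ≃ₜ X :=
    { toFun := fun x => α (γ (c x)) x
      invFun := fun y => α (γ (c' y))⁻¹ y
      left_inv := by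
        intro x
        have : c' (α (γ (c x)) x) = c x := by
          apply hcu'
          rw [actC_apply, map_inv, hinv_apply_self]
          exact hc x
        simp only [this]
        rw [map_inv, hinv_apply_self]
      right_inv := by
        intro y
        have : c (α (γ (c' y))⁻¹ y) = c' y := by
          apply hcu
          exact hc' y
        simp only [this]
        rw [map_inv, hself_apply_inv]
      continuous_toFun := by
        rw [continuous_iff_continuousAt]
        intro x
        exact (α (γ (c x))).continuous.continuousAt.congr
          (Filter.EventuallyEq.symm (hloc x))
      continuous_invFun := by
        rw [continuous_iff_continuousAt]
        intro x
        exact (α (γ (c' x))⁻¹).continuous.continuousAt.congr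
          (Filter.EventuallyEq.symm (hloc' x)) }
  refine ⟨g, fun x => ⟨γ (c x), hloc x⟩, fun i x hi => ?_⟩
  change α (γ (c x)) x = _
  rw [hcu i x hi]

theorem realize_homeo (α : Γ →* X ≃ₜ X) (hcan : IsCancellative α) (A B : Set X)
    (hA : IsClopen A) (hB : IsClopen B) (h : cls α (ind A hA) = cls α (ind B hB)) :
    ∃ g : X ≃ₜ X, Loc α g ∧ ∀ x, x ∈ A ↔ g x ∈ B := by
  classical
  have hc : ∀ (A : Set X) (hA : IsClopen A), ind A hA + ind Aᶜ hA.compl = 1 := by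
    intro A hA
    ext x
    by_cases hx : x ∈ A <;> simp [hx]
  have h' : cls α (ind Aᶜ hA.compl) = cls α (ind Bᶜ hB.compl) := by
    refine hcan (cls α (ind A hA)) _ _ ?_
    rw [← cls_add, hc, h, ← cls_add, hc]
  rw [cls_eq] at h h'
  obtain ⟨ι, _, u, γ, h1, h2⟩ := EqD_family α h
  obtain ⟨ι', _, u', γ', h1', h2'⟩ := EqD_family α h'
  obtain ⟨g, hg, hgu⟩ := exists_homeo α (Sum.elim u u') (Sum.elim γ γ') (by
      intro x
      have := DFunLike.congr_fun (hc A hA) x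
      rw [h1, h1'] at this
      simpa [ContinuousMap.sum_apply] using this) (by
      intro x
      have := DFunLike.congr_fun (hc B hB) x
      rw [h2, h2'] at this
      simpa [ContinuousMap.sum_apply] using this)
  have key : ∀ (ι : Type) [Fintype ι] (u : ι → C(X, ℕ)) (γ : ι → Γ) (A B : Set X)
      (hA : IsClopen A) (hB : IsClopen B), ind A hA = ∑ i, u i →
      ind B hB = ∑ i, actC α (γ i) (u i) → (∀ i x, u i x ≠ 0 → g x = α (γ i) x) →
      ∀ x ∈ A, g x ∈ B := by
    intro ι _ u γ A B hA hB h1 h2 hg x hx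
    have e1 := DFunLike.congr_fun h1 x
    rw [ContinuousMap.sum_apply, ind_apply, if_pos hx] at e1
    obtain ⟨i, hi⟩ : ∃ i, u i x ≠ 0 := by
      by_contra hne
      push Not at hne
      simp [hne] at e1
    have e2 := DFunLike.congr_fun h2 (g x)
    rw [ContinuousMap.sum_apply, ind_apply] at e2
    by_contra hxB
    rw [if_neg hxB] at e2
    have e3 := (Finset.sum_eq_zero_iff.1 e2.symm) i (Finset.mem_univ i)
    rw [hg i x hi, actC_apply, map_inv, hinv_apply_self] at e3
    exact hi e3
  refine ⟨g, hg, fun x => ⟨key ι u γ A B hA hB h1 h2 (fun i => hgu (Sum.inl i)) x, fun hx => ?_⟩⟩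
  by_contra hxA
  exact key ι' u' γ' _ _ hA.compl hB.compl h1' h2' (fun i => hgu (Sum.inr i)) x hxA hx

theorem realize_pieces (α : Γ →* X ≃ₜ X) (A : Set X) (hA : IsClopen A) {K : Type} [Fintype K]
    (b : K → TypeSemigroup α) (h : cls α (ind A hA) = ∑ k, b k) :
    ∃ (P : K → Set X) (hP : ∀ k, IsClopen (P k)), (∀ k, P k ⊆ A) ∧ (∀ x ∈ A, ∃ k, x ∈ P k) ∧
      (∀ k k' x, x ∈ P k → x ∈ P k' → k = k') ∧ ∀ k, cls α (ind (P k) (hP k)) = b k := by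
  classical
  choose f hf using fun k => cls_surj α (b k)
  have h' : cls α (∑ k, f k) = cls α (ind A hA) := by
    rw [h, cls_sum]; simp_rw [hf]
  rw [cls_eq] at h'
  obtain ⟨s, hs, hs'⟩ := EqD_split_sum α _ _ _ h'
  have hsx : ∀ x, (if x ∈ A then 1 else 0) = ∑ k, s k x := by
    intro x
    have := DFunLike.congr_fun hs x
    rwa [ContinuousMap.sum_apply, ind_apply] at this
  have hP : ∀ k, IsClopen {x | s k x ≠ 0} := fun k =>
    (isClopen_discrete {n : ℕ | n ≠ 0}).preimage (s k).continuous
  have hle : ∀ k x, s k x ≤ if x ∈ A then 1 else 0 := by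
    intro k x
    rw [hsx]
    exact Finset.single_le_sum (f := fun k => s k x) (fun _ _ => Nat.zero_le _) (Finset.mem_univ k)
  refine ⟨fun k => {x | s k x ≠ 0}, hP, ?_, ?_, ?_, ?_⟩
  · intro k x hx
    by_contra hxA
    have := hle k x
    rw [if_neg hxA] at this
    have hx' : s k x ≠ 0 := hx
    omega
  · intro x hx
    by_contra hne
    push Not at hne
    have h1 := hsx x
    have h2 : ∀ k, s k x = 0 := by simpa using hne
    simp [h2, hx] at h1
  · intro k k' x hk hk'
    by_contra hkk
    have := Finset.sum_le_sum_of_subset (f := fun k => s k x) (Finset.subset_univ {k, k'})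
    rw [Finset.sum_pair hkk, ← hsx] at this
    have h1 : s k x ≠ 0 := hk
    have h2 : s k' x ≠ 0 := hk'
    split_ifs at this <;> omega
  · intro k
    rw [← hf k, eq_comm, cls_eq]
    convert hs' k (Finset.mem_univ k) using 2
    ext x
    have := hle k x
    rw [ind_apply]
    simp only [Set.mem_ofPred_eq]
    split_ifs at * <;> omega

/-- T-level facts -/
theorem T_conical (α : Γ →* X ≃ₜ X) (a b : TypeSemigroup α) (h : a + b = 0) : a = 0 := by
  obtain ⟨f, rfl⟩ := cls_surj α a
  obtain ⟨g, rfl⟩ := cls_surj α b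
  rw [← cls_add, ← cls_zero, cls_eq] at h
  have := EqD_zero α (EqD_symm α h)
  have hf : f = 0 := by
    ext x; have := DFunLike.congr_fun this x; simp at this ⊢; omega
  rw [hf, cls_zero]

theorem T_refine (α : Γ →* X ≃ₜ X) (a b c d : TypeSemigroup α) (h : a + b = c + d) :
    ∃ x y z w, a = x + y ∧ b = z + w ∧ c = x + z ∧ d = y + w := by
  obtain ⟨f, rfl⟩ := cls_surj α a
  obtain ⟨g, rfl⟩ := cls_surj α b
  obtain ⟨k, rfl⟩ := cls_surj α c
  obtain ⟨l, rfl⟩ := cls_surj α d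
  rw [← cls_add, ← cls_add, cls_eq] at h
  obtain ⟨s, t, hst, hs, ht⟩ := EqD_split α h _ _ rfl
  obtain ⟨p, q, r, u, rfl, rfl, rfl, rfl⟩ := refine22 _ _ _ _ hst
  refine ⟨cls α p, cls α r, cls α q, cls α u, ?_, ?_, ?_, ?_⟩
  · rw [← cls_add, cls_eq]; exact hs
  · rw [← cls_add, cls_eq]; exact ht
  · rw [← cls_add]
  · rw [← cls_add]

end PartD

section PartE

open Topology

variable {Γ : Type*} [Group Γ] {X : Type*} [TopologicalSpace X]

theorem perm_apply_inv {J : Type*} (σ : Equiv.Perm J) (j : J) : σ (σ⁻¹ j) = j :=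
  σ.apply_symm_apply j

theorem perm_inv_apply {J : Type*} (σ : Equiv.Perm J) (j : J) : σ⁻¹ (σ j) = j :=
  σ.symm_apply_apply j

/-- A finite tower structure. -/
structure Stage (α : Γ →* X ≃ₜ X) where
  J : Type
  D : Type
  fJ : Fintype J
  fD : Fintype D
  cl : J → D
  g : J → X ≃ₜ X
  hg : ∀ j, Loc α (g j)
  base : D → Set X
  hbase : ∀ d, IsClopen (base d)
  idx : X → J
  hidx : IsLocallyConstant idx
  spec : ∀ j y, idx ((g j)⁻¹ y) = j ↔ y ∈ base (cl j)

attribute [instance] Stage.fJ Stage.fD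

namespace Stage

variable {α : Γ →* X ≃ₜ X}

theorem mem_base (S : Stage α) (x : X) : S.g (S.idx x) x ∈ S.base (S.cl (S.idx x)) := by
  rw [← S.spec, hinv_apply_self]

/-- the finite group of a stage -/
def grp (S : Stage α) : Subgroup (X ≃ₜ X) where
  carrier := {l | ∃ σ : Equiv.Perm S.J, (∀ j, S.cl (σ j) = S.cl j) ∧
    ∀ x, S.idx (l x) = σ (S.idx x) ∧ S.g (S.idx (l x)) (l x) = S.g (S.idx x) x}
  mul_mem' := by
    rintro l l' ⟨σ, h1, h2⟩ ⟨σ', h1', h2'⟩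
    refine ⟨σ * σ', fun j => by rw [Equiv.Perm.mul_apply, h1, h1'], fun x => ?_⟩
    rw [hmul_apply]
    refine ⟨by rw [(h2 _).1, (h2' _).1]; rfl, ?_⟩
    rw [(h2 _).2, (h2' _).2]
  one_mem' := ⟨1, fun j => rfl, fun x => ⟨rfl, rfl⟩⟩
  inv_mem' := by
    rintro l ⟨σ, h1, h2⟩
    refine ⟨σ⁻¹, fun j => ?_, fun x => ?_⟩
    · have := h1 (σ⁻¹ j)
      rw [← this, perm_apply_inv]
    · have := h2 (l⁻¹ x)
      rw [hself_apply_inv] at this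
      refine ⟨?_, this.2.symm⟩
      rw [this.1, perm_inv_apply]

theorem mem_grp (S : Stage α) (l : X ≃ₜ X) : l ∈ S.grp ↔ ∃ σ : Equiv.Perm S.J,
    (∀ j, S.cl (σ j) = S.cl j) ∧
    ∀ x, S.idx (l x) = σ (S.idx x) ∧ S.g (S.idx (l x)) (l x) = S.g (S.idx x) x := Iff.rfl

theorem grp_finite (S : Stage α) : (S.grp : Set (X ≃ₜ X)).Finite := by
  classical
  have : ∀ l : S.grp, ∃ σ : Equiv.Perm S.J,
    ∀ x, S.idx (l.1 x) = σ (S.idx x) ∧ S.g (S.idx (l.1 x)) (l.1 x) = S.g (S.idx x) x := by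
    intro l
    obtain ⟨σ, -, h⟩ := (S.mem_grp _).1 l.2
    exact ⟨σ, h⟩
  choose σ hσ using this
  have inj : Function.Injective σ := by
    intro l l' hll
    apply Subtype.ext
    apply Homeomorph.ext
    intro x
    have h1 := hσ l x
    have h2 := hσ l' x
    rw [hll, ← h2.1] at h1
    rw [h1.1, ← h2.2] at h1
    exact (S.g _).injective h1.2
  exact Finite.of_injective σ inj

theorem grp_Loc (S : Stage α) (l : X ≃ₜ X) (hl : l ∈ S.grp) : Loc α l := by
  obtain ⟨σ, h1, h2⟩ := (S.mem_grp _).1 hl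
  intro x
  obtain ⟨γ, hγ⟩ := Loc_mul α (Loc_inv α (S.hg (σ (S.idx x)))) (S.hg (S.idx x)) x
  refine ⟨γ, ?_⟩
  filter_upwards [hγ, S.hidx.eventually_eq x] with y hy hy'
  rw [← hy, hmul_apply]
  have := (h2 y).2
  rw [(h2 y).1, hy'] at this
  rw [← this, hinv_apply_self]

theorem exists_of_perm (S : Stage α) (σ : Equiv.Perm S.J) (hσ : ∀ j, S.cl (σ j) = S.cl j) :
    ∃ l ∈ S.grp, ∀ x, S.idx (l x) = σ (S.idx x) := by
  let act : Equiv.Perm S.J → X → X := fun σ x => (S.g (σ (S.idx x)))⁻¹ (S.g (S.idx x) x)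
  have hact : ∀ (σ : Equiv.Perm S.J) (hσ : ∀ j, S.cl (σ j) = S.cl j) x,
      S.idx (act σ x) = σ (S.idx x) := by
    intro σ hσ x
    rw [S.spec, hσ]
    exact S.mem_base x
  have hg : ∀ (σ : Equiv.Perm S.J) (hσ : ∀ j, S.cl (σ j) = S.cl j) x,
      S.g (S.idx (act σ x)) (act σ x) = S.g (S.idx x) x := by
    intro σ hσ x
    rw [hact σ hσ, hself_apply_inv]
  have hcont : ∀ (σ : Equiv.Perm S.J), Continuous (act σ) := by
    intro σ
    rw [continuous_iff_continuousAt]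
    intro x
    refine ((S.g (σ (S.idx x)))⁻¹ * S.g (S.idx x)).continuous.continuousAt.congr ?_
    filter_upwards [S.hidx.eventually_eq x] with y hy
    simp only [act, hy]
    rfl
  have hinv : ∀ (σ : Equiv.Perm S.J) (hσ : ∀ j, S.cl (σ j) = S.cl j) x,
      act σ⁻¹ (act σ x) = x := by
    intro σ hσ x
    change (S.g (σ⁻¹ (S.idx (act σ x))))⁻¹ (S.g (S.idx (act σ x)) (act σ x)) = x
    rw [hg σ hσ, hact σ hσ, perm_inv_apply, hinv_apply_self]
  have hσ' : ∀ j, S.cl (σ⁻¹ j) = S.cl j := by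
    intro j
    have := hσ (σ⁻¹ j)
    rw [← this, perm_apply_inv]
  let l : X ≃ₜ X :=
    { toFun := act σ
      invFun := act σ⁻¹
      left_inv := hinv σ hσ
      right_inv := by
        intro x
        have := hinv σ⁻¹ hσ' x
        rwa [inv_inv] at this
      continuous_toFun := hcont _
      continuous_invFun := hcont _ }
  exact ⟨l, ⟨σ, hσ, fun x => ⟨hact σ hσ x, hg σ hσ x⟩⟩, hact σ hσ⟩

/-- initial stage -/
def init (α : Γ →* X ≃ₜ X) : Stage α where
  J := Unit
  D := Unit
  fJ := inferInstance
  fD := inferInstance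
  cl := id
  g _ := 1
  hg _ := Loc_one α
  base _ := Set.univ
  hbase _ := isClopen_univ
  idx _ := ()
  hidx := IsLocallyConstant.const ()
  spec _ _ := by simp

/-- refinement data -/
structure Ref (S : Stage α) where
  K : Type
  D' : Type
  fK : Fintype K
  fD' : Fintype D'
  pc : K → S.D
  piece : K → Set X
  hpiece : ∀ k, IsClopen (piece k)
  hsub : ∀ k, piece k ⊆ S.base (pc k)
  hex : ∀ c, ∀ y ∈ S.base c, ∃ k, pc k = c ∧ y ∈ piece k
  huniq : ∀ k k' y, pc k = pc k' → y ∈ piece k → y ∈ piece k' → k = k'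
  cl' : K → D'
  h : K → X ≃ₜ X
  hh : ∀ k, Loc α (h k)
  base' : D' → Set X
  hbase' : ∀ d, IsClopen (base' d)
  hspec : ∀ k y, y ∈ piece k ↔ h k y ∈ base' (cl' k)

attribute [instance] Ref.fK Ref.fD'

/-- chosen piece -/
noncomputable def Ref.kf {S : Stage α} (R : Ref S) (x : X) : R.K :=
  Classical.choose (R.hex _ _ (S.mem_base x))

theorem Ref.kf_pc {S : Stage α} (R : Ref S) (x : X) : R.pc (R.kf x) = S.cl (S.idx x) :=
  (Classical.choose_spec (R.hex _ _ (S.mem_base x))).1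

theorem Ref.kf_mem {S : Stage α} (R : Ref S) (x : X) : S.g (S.idx x) x ∈ R.piece (R.kf x) :=
  (Classical.choose_spec (R.hex _ _ (S.mem_base x))).2

theorem Ref.kf_eq {S : Stage α} (R : Ref S) (x : X) (k : R.K) (h1 : R.pc k = S.cl (S.idx x))
    (h2 : S.g (S.idx x) x ∈ R.piece k) : R.kf x = k :=
  R.huniq _ _ _ ((R.kf_pc x).trans h1.symm) (R.kf_mem x) h2

open Classical in
/-- refined stage -/
noncomputable def Ref.stage {S : Stage α} (R : Ref S) : Stage α where
  J := {jk : S.J × R.K // S.cl jk.1 = R.pc jk.2}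
  D := R.D'
  fJ := inferInstance
  fD := inferInstance
  cl jk := R.cl' jk.1.2
  g jk := R.h jk.1.2 * S.g jk.1.1
  hg jk := Loc_mul α (R.hh _) (S.hg _)
  base := R.base'
  hbase := R.hbase'
  idx x := ⟨(S.idx x, R.kf x), (R.kf_pc x).symm⟩
  hidx := by
    rw [IsLocallyConstant.iff_eventually_eq]
    intro x
    have hc := (R.hpiece (R.kf x)).isOpen.preimage (S.g (S.idx x)).continuous
    filter_upwards [S.hidx.eventually_eq x, hc.mem_nhds (R.kf_mem x)] with y hy hy'
    apply Subtype.ext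
    refine Prod.ext hy ?_
    refine R.kf_eq y _ ?_ ?_
    · rw [R.kf_pc, hy]
    · rw [hy]; exact hy'
  spec := by
    rintro ⟨⟨j, k⟩, hjk⟩ y
    simp only at hjk
    have e : (R.h k * S.g j)⁻¹ y = (S.g j)⁻¹ ((R.h k)⁻¹ y) := by rw [mul_inv_rev]; rfl
    simp only [e, Subtype.mk.injEq, Prod.mk.injEq]
    have hs := R.hspec k ((R.h k)⁻¹ y)
    rw [hself_apply_inv] at hs
    rw [← hs]
    constructor
    · rintro ⟨h1, h2⟩
      have := R.kf_mem ((S.g j)⁻¹ ((R.h k)⁻¹ y))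
      rwa [h2, h1, hself_apply_inv] at this
    · intro h
      have h1 : S.idx ((S.g j)⁻¹ ((R.h k)⁻¹ y)) = j := by
        rw [S.spec, hjk]; exact R.hsub _ h
      refine ⟨h1, R.kf_eq _ _ ?_ ?_⟩
      · rw [h1, hjk]
      · rw [h1, hself_apply_inv]; exact h

theorem Ref.grp_le {S : Stage α} (R : Ref S) : S.grp ≤ R.stage.grp := by
  rintro l hl
  obtain ⟨σ, h1, h2⟩ := (S.mem_grp _).1 hl
  have hσ' : ∀ j, S.cl (σ⁻¹ j) = S.cl j := by
    intro j
    have := h1 (σ⁻¹ j)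
    rw [← this, perm_apply_inv]
  have hk : ∀ x, R.kf (l x) = R.kf x := by
    intro x
    apply R.kf_eq
    · rw [(h2 x).1, h1, R.kf_pc]
    · rw [(h2 x).2]; exact R.kf_mem x
  refine ⟨⟨fun jk => ⟨(σ jk.1.1, jk.1.2), (h1 _).trans jk.2⟩,
    fun jk => ⟨(σ⁻¹ jk.1.1, jk.1.2), (hσ' _).trans jk.2⟩, ?_, ?_⟩, ?_, ?_⟩
  · rintro ⟨⟨j, k⟩, h⟩; exact Subtype.ext (Prod.ext (σ.symm_apply_apply j) rfl)
  · rintro ⟨⟨j, k⟩, h⟩; exact Subtype.ext (Prod.ext (σ.apply_symm_apply j) rfl)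
  · rintro ⟨⟨j, k⟩, h⟩; rfl
  · intro x
    refine ⟨Subtype.ext (Prod.ext (h2 x).1 (hk x)), ?_⟩
    change R.h (R.kf (l x)) (S.g (S.idx (l x)) (l x)) = R.h (R.kf x) (S.g (S.idx x) x)
    rw [hk, (h2 x).2]

open Classical in
/-- refinement making a function measurable -/
noncomputable def measRef (S : Stage α) {Z : Type} [Fintype Z] (F : X → Z)
    (hF : IsLocallyConstant F) : Ref S where
  K := S.D × (S.J → Z)
  D' := S.D × (S.J → Z)
  fK := inferInstance
  fD' := inferInstance
  pc := Prod.fst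
  piece k := S.base k.1 ∩ ⋂ j, (fun y => F ((S.g j)⁻¹ y)) ⁻¹' {k.2 j}
  hpiece k := (S.hbase _).inter (isClopen_iInter_of_finite fun j =>
    (hF.isClopen_fiber (k.2 j)).preimage ((S.g j)⁻¹ : X ≃ₜ X).continuous)
  hsub k := Set.inter_subset_left
  hex c y hy := ⟨(c, fun j => F ((S.g j)⁻¹ y)), rfl, hy, by simp⟩
  huniq := by
    rintro ⟨c, w⟩ ⟨c', w'⟩ y h ⟨_, h1⟩ ⟨_, h2⟩
    refine Prod.ext h (funext fun j => ?_)
    have e1 := Set.mem_iInter.1 h1 j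
    have e2 := Set.mem_iInter.1 h2 j
    exact (Eq.symm e1).trans e2
  cl' := id
  h _ := 1
  hh _ := Loc_one α
  base' k := S.base k.1 ∩ ⋂ j, (fun y => F ((S.g j)⁻¹ y)) ⁻¹' {k.2 j}
  hbase' k := (S.hbase _).inter (isClopen_iInter_of_finite fun j =>
    (hF.isClopen_fiber (k.2 j)).preimage ((S.g j)⁻¹ : X ≃ₜ X).continuous)
  hspec k y := Iff.rfl

theorem exists_meas (S : Stage α) {Z : Type} [Fintype Z] (F : X → Z)
    (hF : IsLocallyConstant F) : ∃ S' : Stage α, S.grp ≤ S'.grp ∧ ∃ u : S'.J → Z,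
      ∀ x, F x = u (S'.idx x) := by
  refine ⟨(measRef S F hF).stage, (measRef S F hF).grp_le, fun jk => jk.1.2.2 jk.1.1, fun x => ?_⟩
  have := Set.mem_iInter.1 ((measRef S F hF).kf_mem x).2 (S.idx x)
  have e : F ((S.g (S.idx x))⁻¹ (S.g (S.idx x) x)) = ((measRef S F hF).kf x).2 (S.idx x) := this
  rwa [hinv_apply_self] at e

end Stage

/-- matching lemma -/
theorem exists_perm {J Z : Type} [Fintype J] [DecidableEq Z] (u v : J → Z)
    (h : ∀ z, (Finset.univ.filter fun j => u j = z).card =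
      (Finset.univ.filter fun j => v j = z).card) : ∃ σ : Equiv.Perm J, ∀ j, u (σ j) = v j := by
  have : ∀ z, Nonempty ({j // v j = z} ≃ {j // u j = z}) := by
    intro z
    rw [← Fintype.card_eq, Fintype.card_subtype, Fintype.card_subtype, h]
  let e := fun z => (this z).some
  refine ⟨(Equiv.sigmaFiberEquiv v).symm.trans ((Equiv.sigmaCongrRight e).trans
    (Equiv.sigmaFiberEquiv u)), fun j => ?_⟩
  exact (e (v j) ⟨j, rfl⟩).2

end PartE

section PartF

open Topology

open Classical in
/-- counting lemma -/
theorem count_aux {J C κ : Type} [Fintype J] [Fintype C] [Fintype κ] (cl : J → C)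
    (m : C → κ → ℕ) (w : J → ℕ) (d : κ) (n : ℕ) :
    (Finset.univ.filter fun jk : {jk : J × (Σ c, Σ d, Fin (m c d)) // cl jk.1 = jk.2.1} =>
      (jk.1.2.2.1, w jk.1.1) = (d, n)).card =
    ∑ c, (Finset.univ.filter fun j => cl j = c ∧ w j = n).card * m c d := by
  have h1 : (Finset.univ.filter fun jk : {jk : J × (Σ c, Σ d, Fin (m c d)) // cl jk.1 = jk.2.1} =>
      (jk.1.2.2.1, w jk.1.1) = (d, n)).card =
      (Finset.univ.filter fun jk : J × (Σ c, Σ d, Fin (m c d)) =>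
        cl jk.1 = jk.2.1 ∧ jk.2.2.1 = d ∧ w jk.1 = n).card := by
    refine Finset.card_bij (fun a _ => a.1) ?_ ?_ ?_
    · rintro ⟨a, ha⟩ h
      simp only [Finset.mem_filter, Finset.mem_univ, true_and, Prod.mk.injEq] at h ⊢
      exact ⟨ha, h⟩
    · intro a _ b _ h
      exact Subtype.ext h
    · intro b hb
      simp only [Finset.mem_filter, Finset.mem_univ, true_and] at hb
      exact ⟨⟨b, hb.1⟩, by simpa using hb.2, rfl⟩
  rw [h1, Finset.card_filter, Fintype.sum_prod_type]
  simp only [Finset.card_filter, Finset.sum_mul]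
  rw [Finset.sum_comm]
  conv_rhs => rw [Finset.sum_comm]
  conv_lhs => rw [Finset.sum_comm]
  refine Finset.sum_congr rfl fun j _ => ?_
  rw [Fintype.sum_sigma]
  refine Finset.sum_congr rfl fun c _ => ?_
  rw [Fintype.sum_sigma, Finset.sum_eq_single d]
  · by_cases hc : cl j = c <;> by_cases hw : w j = n <;> simp [hc, hw]
  · intro d' _ hd'
    simp [hd']
  · simp

variable {Γ : Type*} [Group Γ] {X : Type*} [TopologicalSpace X] [CompactSpace X] [T2Space X]
  [TotallyDisconnectedSpace X] {α : Γ →* X ≃ₜ X}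

theorem cls_of_Loc (g : X ≃ₜ X) (hg : Loc α g) (A B : Set X) (hA : IsClopen A) (hB : IsClopen B)
    (h : ∀ x, x ∈ A ↔ g x ∈ B) : cls α (ind A hA) = cls α (ind B hB) := by
  rw [cls_eq]
  have := full_EqD α g (full_of_Loc α g hg) (ind A hA)
  convert this using 2
  ext x
  rw [ContinuousMap.comp_apply, ind_apply, ind_apply]
  have := h (g⁻¹ x)
  rw [hself_apply_inv] at this
  by_cases hx : x ∈ B
  · rw [if_pos hx]; exact (if_pos (this.2 hx)).symm
  · rw [if_neg hx]; exact (if_neg (fun h => hx (this.1 h))).symm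

open Classical in
theorem cls_count (S : Stage α) (f : C(X, ℕ)) (u : S.J → ℕ) (hu : ∀ x, f x = u (S.idx x)) (n : ℕ)
    (hn : IsClopen {x | f x = n}) :
    cls α (ind {x | f x = n} hn) = ∑ c, (Finset.univ.filter fun j => S.cl j = c ∧ u j = n).card •
      cls α (ind (S.base c) (S.hbase c)) := by
  have h1 : ind {x | f x = n} hn = ∑ j ∈ Finset.univ.filter (fun j => u j = n),
      ind {x | S.idx x = j} (S.hidx.isClopen_fiber j) := by
    ext x
    rw [ContinuousMap.sum_apply, ind_apply]
    simp only [ind_apply, Set.mem_setOf_eq, hu]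
    rw [Finset.sum_ite_eq]
    simp
  have h2 : ∀ j, cls α (ind {x | S.idx x = j} (S.hidx.isClopen_fiber j)) =
      cls α (ind (S.base (S.cl j)) (S.hbase (S.cl j))) := by
    intro j
    refine cls_of_Loc (S.g j) (S.hg j) _ _ _ _ fun x => ?_
    rw [← S.spec, hinv_apply_self]; rfl
  rw [h1, cls_sum]
  simp only [h2]
  rw [← Finset.sum_fiberwise_of_maps_to (s := Finset.univ.filter (fun j => u j = n))
    (t := Finset.univ) (g := S.cl) (fun _ _ => Finset.mem_univ _)]
  refine Finset.sum_congr rfl fun c _ => ?_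
  rw [Finset.sum_congr rfl (g := fun _ => cls α (ind (S.base c) (S.hbase c)))]
  · rw [Finset.sum_const, Finset.filter_filter]
    congr 2
    ext j; simp [and_comm]
  · intro j hj
    rw [Finset.mem_filter] at hj
    obtain ⟨_, rfl⟩ := hj
    rfl

open Classical in
theorem step (hunp : IsUnperforated α) (hcan : IsCancellative α) (S : Stage α) (f f' : C(X, ℕ))
    (g : X ≃ₜ X) (hg : Loc α g) (hfg : ∀ x, f' x = f (g x)) :
    ∃ S' : Stage α, S.grp ≤ S'.grp ∧ ∃ l ∈ S'.grp, ∀ x, f' x = f (l x) := by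
  obtain ⟨N, hN⟩ := exists_bound f
  have hN' : ∀ x, f' x < N := fun x => by rw [hfg]; exact hN _
  obtain ⟨S1, hS1, w, hw⟩ := S.exists_meas (Z := Fin N × Fin N)
    (fun x => (⟨f x, hN x⟩, ⟨f' x, hN' x⟩)) (by
      rw [IsLocallyConstant.iff_eventually_eq]
      intro x
      have e1 := (IsLocallyConstant.iff_continuous _).2 f.continuous |>.eventually_eq x
      have e2 := (IsLocallyConstant.iff_continuous _).2 f'.continuous |>.eventually_eq x
      filter_upwards [e1, e2] with y h1 h2
      exact Prod.ext (Fin.ext h1) (Fin.ext h2))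
  let u : S1.J → ℕ := fun j => (w j).1
  let v : S1.J → ℕ := fun j => (w j).2
  have hu : ∀ x, f x = u (S1.idx x) := fun x => by
    have := congrArg (fun z => (z.1 : ℕ)) (hw x); exact this
  have hv : ∀ x, f' x = v (S1.idx x) := fun x => by
    have := congrArg (fun z => (z.2 : ℕ)) (hw x); exact this
  have hcl : ∀ (f : C(X, ℕ)) n, IsClopen {x | f x = n} := fun f n =>
    ((IsLocallyConstant.iff_continuous _).2 f.continuous).isClopen_fiber n
  obtain ⟨κ, _, b, m, hm, hc⟩ := shen_multi hcan (T_conical α) (T_refine α)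
    (fun a b c n hn h => hunp a b n hn ⟨c, h⟩) N
    (fun c => cls α (ind (S1.base c) (S1.hbase c)))
    (fun n c => (Finset.univ.filter fun j => S1.cl j = c ∧ u j = n).card)
    (fun n c => (Finset.univ.filter fun j => S1.cl j = c ∧ v j = n).card) (fun n _ => by
      rw [← cls_count S1 f u hu n (hcl f n), ← cls_count S1 f' v hv n (hcl f' n)]
      symm
      refine cls_of_Loc g hg _ _ _ _ fun x => ?_
      simp only [Set.mem_setOf_eq, hfg])
  have hp : ∀ c, _ := fun c => realize_pieces α (S1.base c) (S1.hbase c)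
    (K := Σ d, Fin (m c d)) (fun k => b k.1) (by
      rw [hm c, Fintype.sum_sigma]
      simp)
  choose P hP hsub hex huniq hPb using hp
  let K := Σ c, Σ d, Fin (m c d)
  let pcs : K → Set X := fun k => P k.1 k.2
  let base' : κ → Set X := fun d => if h : ∃ k : K, k.2.1 = d then pcs h.choose else ∅
  have hbase' : ∀ d, IsClopen (base' d) := by
    intro d
    by_cases h : ∃ k : K, k.2.1 = d
    · simp only [base', dif_pos h]; exact hP _ _
    · simp only [base', dif_neg h]; exact isClopen_empty
  have hbc : ∀ k : K, cls α (ind (pcs k) (hP k.1 k.2)) =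
      cls α (ind (base' k.2.1) (hbase' k.2.1)) := by
    intro k
    have h : ∃ k' : K, k'.2.1 = k.2.1 := ⟨k, rfl⟩
    have e : base' k.2.1 = pcs h.choose := dif_pos h
    have e2 : cls α (ind (base' k.2.1) (hbase' k.2.1)) =
      cls α (ind (pcs h.choose) (hP h.choose.1 h.choose.2)) := by
      congr 2
    rw [e2]
    have a1 := hPb k.1 k.2
    have a2 := hPb h.choose.1 h.choose.2
    have e3 := congrArg b h.choose_spec
    exact a1.trans (e3.symm.trans a2.symm)
  choose hh hhL hhs using fun k : K => realize_homeo α hcan _ _ _ _ (hbc k)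
  let R : Stage.Ref S1 :=
    { K := K
      D' := κ
      fK := inferInstance
      fD' := inferInstance
      pc := fun k => k.1
      piece := pcs
      hpiece := fun k => hP k.1 k.2
      hsub := fun k => hsub k.1 k.2
      hex := fun c y hy => by
        obtain ⟨k, hk⟩ := hex c y hy
        exact ⟨⟨c, k⟩, rfl, hk⟩
      huniq := by
        rintro ⟨c, k⟩ ⟨c', k'⟩ y h h1 h2
        obtain rfl : c = c' := h
        rw [huniq c k k' y h1 h2]
      cl' := fun k => k.2.1
      h := hh
      hh := hhL
      base' := base'
      hbase' := hbase'
      hspec := hhs }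
  let ju : {jk : S1.J × K // S1.cl jk.1 = jk.2.1} → κ × ℕ := fun jk => (jk.1.2.2.1, u jk.1.1)
  let jv : {jk : S1.J × K // S1.cl jk.1 = jk.2.1} → κ × ℕ := fun jk => (jk.1.2.2.1, v jk.1.1)
  obtain ⟨σ, hσ⟩ := exists_perm ju jv (by
    rintro ⟨d, n⟩
    have c1 := count_aux S1.cl m u d n
    have c2 := count_aux S1.cl m v d n
    by_cases hn : n < N
    · exact c1.trans ((hc n hn d).trans c2.symm)
    · rw [Finset.filter_eq_empty_iff.2, Finset.filter_eq_empty_iff.2]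
      · intro jk _ h
        have h2 : ((w jk.1.1).2 : ℕ) = n := congrArg Prod.snd h
        exact hn (h2 ▸ (w jk.1.1).2.2)
      · intro jk _ h
        have h2 : ((w jk.1.1).1 : ℕ) = n := congrArg Prod.snd h
        exact hn (h2 ▸ (w jk.1.1).1.2))
  obtain ⟨l, hl, hl'⟩ := R.stage.exists_of_perm σ (fun jk => congrArg Prod.fst (hσ jk))
  refine ⟨R.stage, hS1.trans R.grp_le, l, hl, fun x => ?_⟩
  have e1 : S1.idx (l x) = (σ (R.stage.idx x)).1.1 := congrArg (fun z => z.1.1) (hl' x)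
  rw [hv, hu, e1]
  exact (congrArg Prod.snd (hσ (R.stage.idx x))).symm

theorem countable_CXN [SecondCountableTopology X] : Countable C(X, ℕ) := by
  have hc : Countable (TopologicalSpace.Clopens X) :=
    TopologicalSpace.Clopens.countable_iff_secondCountable.2 inferInstance
  have hcl : ∀ (f : C(X, ℕ)) n, IsClopen {x | f x = n} := fun f n =>
    ((IsLocallyConstant.iff_continuous _).2 f.continuous).isClopen_fiber n
  choose N hN using fun f : C(X, ℕ) => exists_bound f
  let F : C(X, ℕ) → Σ n : ℕ, (Fin n → TopologicalSpace.Clopens X) := fun f =>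
    ⟨N f, fun i => ⟨{x | f x = i}, hcl f i⟩⟩
  have hF : ∀ f x n, f x = n ↔ ∃ h : n < (F f).1, x ∈ (F f).2 ⟨n, h⟩ := by
    intro f x n
    constructor
    · rintro rfl
      exact ⟨hN f x, rfl⟩
    · rintro ⟨_, h⟩
      exact h
  refine Function.Injective.countable (f := F) fun f f' h => ?_
  ext x
  rw [hF f x, h, ← hF f' x]

theorem backward [SecondCountableTopology X] (hunp : IsUnperforated α) (hcan : IsCancellative α) :
    HasDenseLocallyFiniteSubgroup α := by
  classical
  have := countable_CXN (X := X)
  obtain ⟨en, hen⟩ := exists_surjective_nat (C(X, ℕ) × C(X, ℕ))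
  have hst : ∀ (n : ℕ) (S : Stage α), ∃ S' : Stage α, S.grp ≤ S'.grp ∧
      ((∃ g, Loc α g ∧ ∀ x, (en n).2 x = (en n).1 (g x)) →
        ∃ l ∈ S'.grp, ∀ x, (en n).2 x = (en n).1 (l x)) := by
    intro n S
    by_cases h : ∃ g, Loc α g ∧ ∀ x, (en n).2 x = (en n).1 (g x)
    · obtain ⟨g, h1, h2⟩ := h
      obtain ⟨S', h3, h4⟩ := step hunp hcan S _ _ g h1 h2
      exact ⟨S', h3, fun _ => h4⟩
    · exact ⟨S, le_rfl, fun h' => absurd h' h⟩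
  choose nx hnx1 hnx2 using hst
  let T : ℕ → Stage α := fun n => Nat.rec (Stage.init α) nx n
  have hT : ∀ n, T (n + 1) = nx n (T n) := fun n => rfl
  have hmono : Monotone fun n => (T n).grp := by
    refine monotone_nat_of_le_succ fun n => ?_
    rw [hT]; exact hnx1 _ _
  have hmem : ∀ l, l ∈ (⨆ n, (T n).grp) ↔ ∃ n, l ∈ (T n).grp := fun l =>
    Subgroup.mem_iSup_of_directed hmono.directed_le
  refine ⟨⨆ n, (T n).grp, ?_, ?_, ?_⟩
  · intro l hl
    obtain ⟨n, hn⟩ := (hmem l).1 hl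
    exact full_of_Loc α l ((T n).grp_Loc l hn)
  · intro s hs
    have : ∃ n, (s : Set (X ≃ₜ X)) ⊆ (T n).grp := by
      have h : ∀ l : s, ∃ n, l.1 ∈ (T n).grp := fun l => (hmem _).1 (hs l.2)
      choose k hk using h
      refine ⟨Finset.univ.sup k, fun l hl => ?_⟩
      exact hmono (Finset.le_sup (f := k) (Finset.mem_univ ⟨l, hl⟩)) (hk ⟨l, hl⟩)
    obtain ⟨n, hn⟩ := this
    exact (T n).grp_finite.subset ((Subgroup.closure_le _).2 hn)
  · intro g hg n P hP hdis hcov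
    have hx : ∀ x, ∃ k, x ∈ P k := fun x => by
      have : x ∈ ⋃ i, P i := hcov ▸ Set.mem_univ x
      simpa using this
    choose k hk using hx
    have hk' : ∀ x i, x ∈ P i ↔ (k x : ℕ) = i := by
      intro x i
      constructor
      · intro h
        by_contra hne
        exact Set.disjoint_left.1 (hdis (i := k x) (j := i) fun e => hne (by rw [e])) (hk x) h
      · intro h
        rw [← Fin.ext h]; exact hk x
    have hcont : Continuous fun x => (k x : ℕ) := by
      rw [← IsLocallyConstant.iff_continuous, IsLocallyConstant.iff_eventually_eq]
      intro x
      filter_upwards [(hP (k x)).isOpen.mem_nhds (hk x)] with y hy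
      exact (hk' y _).1 hy
    let f : C(X, ℕ) := ⟨fun x => (k x : ℕ), hcont⟩
    let f' : C(X, ℕ) := f.comp (g⁻¹ : X ≃ₜ X)
    obtain ⟨N, hN⟩ := hen (f, f')
    have := hnx2 N (T N)
    rw [← hT, hN] at this
    obtain ⟨l, hl, hlf⟩ := this ⟨g⁻¹, Loc_inv α (Loc_of_full α g hg), fun x => rfl⟩
    refine ⟨l⁻¹, inv_mem ((hmem l).2 ⟨N + 1, hl⟩), fun i => ?_⟩
    ext x
    have e1 : x ∈ ⇑(l⁻¹ : X ≃ₜ X) '' P i ↔ l x ∈ P i := by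
      constructor
      · rintro ⟨y, hy, rfl⟩; rwa [hself_apply_inv]
      · intro h; exact ⟨_, h, hinv_apply_self _ _⟩
    have e2 : x ∈ ⇑g '' P i ↔ g⁻¹ x ∈ P i := by
      constructor
      · rintro ⟨y, hy, rfl⟩; rwa [hinv_apply_self]
      · intro h; exact ⟨_, h, hself_apply_inv _ _⟩
    rw [e1, e2, hk', hk']
    have : (k (g⁻¹ x) : ℕ) = k (l x) := hlf x
    rw [this]

end PartF

/-- Let `α` be an action of a countable group `Γ` by homeomorphisms on a
compact metrizable `0`-dimensional space `X`. Then the topological full group `⟦α⟧` admits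
a dense locally finite subgroup iff `T(α)` is unperforated and cancellative. -/
theorem stmt2 {Γ : Type*} [Group Γ] [Countable Γ]
    {X : Type*} [TopologicalSpace X] [CompactSpace X]
    [TopologicalSpace.MetrizableSpace X] [TotallyDisconnectedSpace X]
    (α : Γ →* (X ≃ₜ X)) :
    HasDenseLocallyFiniteSubgroup α ↔ (IsUnperforated α ∧ IsCancellative α) := by
  haveI : SecondCountableTopology X := by
    letI := TopologicalSpace.metrizableSpaceMetric X
    infer_instance
  exact ⟨forward α, fun h => backward h.1 h.2⟩
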